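/- Let ψ ∈ F, φ(k) = k/ψ(k), β ∈ ℝ. Then there exists a constant C = C(ψ) > 0 such that for all n ∈ ℕ and all β ∈ ℝ, |E(C^ψ_{β,∞}; Z^φ_n) − (4/π²)·ψ(n)·A_n^ψ| ≤ C·ψ(n), where A_n^ψ = ln n if T(n) ≤ 1; A_n^ψ = ln(n/T(n)) if 1 ≤ T(n) ≤ n; A_n^ψ = ln(T(n)/n) if T(n) ≥ n, with T(n) = η(ψ;n) − n and η(ψ;n) = ψ⁻¹(ψ(n)/2). -/

import Mathlib

open MeasureTheory Real Filter Set

noncomputable section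

/-- The `k`-th Fourier cosine coefficient of a `2π`-periodic function. -/
def fourierA (f : ℝ → ℝ) (k : ℕ) : ℝ := (1 / π) * ∫ t in (-π)..π, f t * Real.cos (k * t)

/-- The `k`-th Fourier sine coefficient of a `2π`-periodic function. -/
def fourierB (f : ℝ → ℝ) (k : ℕ) : ℝ := (1 / π) * ∫ t in (-π)..π, f t * Real.sin (k * t)

/-- The harmonicTerm `A_k(f;x)`. -/
def harmonicTerm (f : ℝ → ℝ) (k : ℕ) (x : ℝ) : ℝ :=
  if k = 0 then fourierA f 0 / 2
  else fourierA f k * Real.cos (k * x) + fourierB f k * Real.sin (k * x)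

/-- `2π`-periodicity. -/
def Periodic2pi (f : ℝ → ℝ) : Prop := ∀ x, f (x + 2 * π) = f x

/-- The set `S_∞`: measurable `2π`-periodic functions essentially bounded by 1. -/
def SInf (φ : ℝ → ℝ) : Prop :=
  Measurable φ ∧ Periodic2pi φ ∧ (∀ᵐ t ∂(volume : Measure ℝ), |φ t| ≤ 1)

/-- `φ` is the `(ψ,β)`-derivative of `f`: `φ ∈ S_∞` and the series
`Σ (1/ψ k)(a_k(f) cos(kx+βπ/2) + b_k(f) sin(kx+βπ/2))` is the Fourier series of `φ`. -/
def IsPsiDeriv (ψ : ℕ → ℝ) (β : ℝ) (f φ : ℝ → ℝ) : Prop :=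
  SInf φ ∧ fourierA φ 0 = 0 ∧
    ∀ k : ℕ, 1 ≤ k →
      fourierA φ k = (1 / ψ k) *
        (fourierA f k * Real.cos (β * π / 2) + fourierB f k * Real.sin (β * π / 2)) ∧
      fourierB φ k = (1 / ψ k) *
        (fourierB f k * Real.cos (β * π / 2) - fourierA f k * Real.sin (β * π / 2))

/-- The class `C^ψ_{β,∞}`. -/
def ClassC (ψ : ℕ → ℝ) (β : ℝ) (f : ℝ → ℝ) : Prop :=
  Continuous f ∧ Periodic2pi f ∧ ∃ φ, IsPsiDeriv ψ β f φ

/-- Multipliers of the sums `U^ψ_{n,p}` (with `φ(k) = (k-n+p)/ψ(k)`). -/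
def lambdaU (ψ : ℕ → ℝ) (n p k : ℕ) : ℝ :=
  if k ≤ n - p then 1
  else 1 - (((k : ℝ) - n + p) / ψ k) / ((p : ℝ) / ψ n)

/-- The sums `U^ψ_{n,p}(f;x)`. -/
def Usum (ψ : ℕ → ℝ) (n p : ℕ) (f : ℝ → ℝ) (x : ℝ) : ℝ :=
  ∑ k ∈ Finset.range n, lambdaU ψ n p k * harmonicTerm f k x

/-- `E(C^ψ_{β,∞}; T) = sup_{f ∈ C^ψ_{β,∞}} ‖f - T f‖_C`. -/
def classSup (ψ : ℕ → ℝ) (β : ℝ) (T : (ℝ → ℝ) → ℝ → ℝ) : ℝ :=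
  sSup {e | ∃ f, ClassC ψ β f ∧ e = ⨆ x : ℝ, |f x - T f x|}

/-- The characteristic `η(ψ;t) = ψ⁻¹(ψ(t)/2)` (inverse taken on `[1,∞)`). -/
def eta (ψ : ℝ → ℝ) (t : ℝ) : ℝ := Function.invFunOn ψ (Set.Ici 1) (ψ t / 2)

/-- The set `M`: positive convex functions on `[1,∞)` vanishing at infinity. -/
def MClass (ψ : ℝ → ℝ) : Prop :=
  (∀ t ≥ (1 : ℝ), 0 < ψ t) ∧ ConvexOn ℝ (Set.Ici 1) ψ ∧ Tendsto ψ atTop (nhds 0)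

/-- The set `F = {ψ ∈ M : η'(ψ;t) ≤ K for all t ≥ 1}`. -/
def FClass (ψ : ℝ → ℝ) : Prop :=
  MClass ψ ∧ ∃ K : ℝ, ∀ t ≥ (1 : ℝ), DifferentiableAt ℝ (eta ψ) t ∧ deriv (eta ψ) t ≤ K

/-- The generalized Zygmund sum `Z^φ_n(f;x) = Σ_{k=0}^{n-1} (1 - φ(k)/φ(n)) A_k(f;x)`. -/
def ZygmundSum (φ : ℕ → ℝ) (n : ℕ) (f : ℝ → ℝ) (x : ℝ) : ℝ :=
  ∑ k ∈ Finset.range n, (1 - φ k / φ n) * harmonicTerm f k x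

/-- Second difference of a sequence. -/
def secondDiff (a : ℕ → ℝ) (i : ℕ) : ℝ := a i - 2 * a (i + 1) + a (i + 2)

lemma sum_range_mul_secondDiff (a : ℕ → ℝ) (N : ℕ) :
    ∑ i ∈ Finset.range N, ((i : ℝ) + 1) * secondDiff a i =
      a 0 - a N - N * (a N - a (N + 1)) := by
  induction N with
  | zero => simp
  | succ N ih =>
    rw [Finset.sum_range_succ, ih, secondDiff]
    push_cast
    ring

lemma sum_range_secondDiff (a : ℕ → ℝ) (N : ℕ) :
    ∑ i ∈ Finset.range N, secondDiff a i = a 0 - a 1 - (a N - a (N + 1)) := by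
  induction N with
  | zero => simp
  | succ N ih =>
    rw [Finset.sum_range_succ, ih, secondDiff]
    ring

lemma antitone_sub_succ {a : ℕ → ℝ} (hc : ∀ i, 0 ≤ secondDiff a i) :
    Antitone fun i => a i - a (i + 1) := by
  refine antitone_nat_of_succ_le fun i => ?_
  have := hc i
  rw [secondDiff] at this
  show a (i + 1) - a (i + 1 + 1) ≤ a i - a (i + 1)
  linarith

lemma tendsto_nat_mul_sub_succ {a : ℕ → ℝ} (ha : Antitone a) (hc : ∀ i, 0 ≤ secondDiff a i)
    (h0 : Tendsto a atTop (nhds 0)) :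
    Tendsto (fun N : ℕ => (N : ℝ) * (a N - a (N + 1))) atTop (nhds 0) := by
  have hd := antitone_sub_succ hc
  have key : ∀ N k : ℕ, (k : ℝ) * (a (N + k) - a (N + k + 1)) ≤ a N - a (N + k) := by
    intro N k
    have h1 : ∑ i ∈ Finset.range k, (a (N + i) - a (N + (i + 1))) = a N - a (N + k) := by
      simpa using Finset.sum_range_sub' (fun i => a (N + i)) k
    rw [← h1]
    calc (k : ℝ) * (a (N + k) - a (N + k + 1))
        = ∑ i ∈ Finset.range k, (a (N + k) - a (N + k + 1)) := by
          rw [Finset.sum_const, Finset.card_range, nsmul_eq_mul]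
      _ ≤ _ := Finset.sum_le_sum fun i hi => hd (by
        have := Finset.mem_range.1 hi
        omega)
  have hhalf : Tendsto (fun N : ℕ => N / 2) atTop atTop :=
    tendsto_atTop_atTop.2 fun b => ⟨2 * b, fun c hc => by omega⟩
  have hb : Tendsto (fun N : ℕ => 3 * a (N / 2)) atTop (nhds 0) := by
    simpa using (h0.comp hhalf).const_mul 3
  refine squeeze_zero (fun N => ?_) (fun N => ?_) hb
  · exact mul_nonneg (Nat.cast_nonneg _) (sub_nonneg.2 (ha (Nat.le_succ N)))
  · have hpos : ∀ i, 0 ≤ a i := fun i => ha.le_of_tendsto h0 i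
    have h1 := key (N / 2) (N - N / 2)
    rw [show N / 2 + (N - N / 2) = N by omega] at h1
    have h2 : (N : ℝ) ≤ 2 * ((N - N / 2 : ℕ) : ℝ) := by
      exact_mod_cast (by omega : N ≤ 2 * (N - N / 2))
    have h3 : 0 ≤ a N - a (N + 1) := sub_nonneg.2 (ha (Nat.le_succ N))
    nlinarith [hpos N, hpos (N / 2)]

lemma hasSum_mul_secondDiff {a : ℕ → ℝ} (ha : Antitone a) (hc : ∀ i, 0 ≤ secondDiff a i)
    (h0 : Tendsto a atTop (nhds 0)) :
    HasSum (fun i : ℕ => ((i : ℝ) + 1) * secondDiff a i) (a 0) := by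
  rw [hasSum_iff_tendsto_nat_of_nonneg (fun i => mul_nonneg (by positivity) (hc i))]
  simp_rw [sum_range_mul_secondDiff]
  simpa using (tendsto_const_nhds.sub h0).sub (tendsto_nat_mul_sub_succ ha hc h0)

/-- A convex null sequence is a superposition of tents. -/
lemma hasSum_tent {a : ℕ → ℝ} (ha : Antitone a) (hc : ∀ i, 0 ≤ secondDiff a i)
    (h0 : Tendsto a atTop (nhds 0)) (j : ℕ) :
    HasSum (fun i : ℕ => ((i : ℝ) + 1) * secondDiff a i * max 0 (1 - (j : ℝ) / ((i : ℝ) + 1)))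
      (a j) := by
  have h1 : HasSum (fun i : ℕ => ((i : ℝ) + 1) * secondDiff (fun i => a (i + j)) i) (a (0 + j)) :=
    hasSum_mul_secondDiff (a := fun i => a (i + j)) (fun x y h => ha (by omega))
      (fun i => by
        have := hc (i + j)
        simpa only [secondDiff, add_right_comm] using this) ((tendsto_add_atTop_iff_nat j).2 h0)
  rw [zero_add] at h1
  rw [← hasSum_nat_add_iff' j]
  have h2 : ∑ i ∈ Finset.range j,
      ((i : ℝ) + 1) * secondDiff a i * max 0 (1 - (j : ℝ) / ((i : ℝ) + 1)) = 0 := by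
    refine Finset.sum_eq_zero fun i hi => ?_
    have hi' : ((i : ℝ) + 1) ≤ j := by exact_mod_cast Finset.mem_range.1 hi
    rw [max_eq_left, mul_zero]
    rw [sub_nonpos, le_div_iff₀ (by positivity)]
    linarith
  rw [h2, sub_zero]
  refine (congrArg (HasSum · (a j)) (funext fun i => ?_)).mpr h1
  have h3 : ((i + j : ℕ) : ℝ) + 1 = (i + 1) + j := by push_cast; ring
  have h4 : 0 < (i : ℝ) + 1 + j := by positivity
  have h5 : 1 - (j : ℝ) / ((i + 1) + j) = (i + 1) / ((i + 1) + j) := by field_simp; ring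
  rw [h3, h5, max_eq_right (by positivity)]
  simp only [secondDiff, add_right_comm]
  field_simp

lemma log_le_sum_tent {m B : ℝ} (hm : 0 < m) (hB : 1 ≤ B) (J : ℕ → ℕ)
    (hJ : ∀ i, (J i : ℝ) ≤ 2 * m * B ^ i) (I : ℕ) {l : ℝ} (hl : 0 < l) (hI : l ≤ 4 * m * B ^ I) :
    Real.log (2 + l / m) ≤ Real.log 6 +
      2 * Real.log B * ∑ i ∈ Finset.range I, max 0 (1 - (J i : ℝ) / l) := by
  have hlogB : 0 ≤ Real.log B := Real.log_nonneg hB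
  induction I with
  | zero =>
    simp only [Finset.range_zero, Finset.sum_empty, mul_zero, add_zero]
    refine Real.log_le_log (by positivity) ?_
    have : l / m ≤ 4 := by rw [div_le_iff₀ hm]; simpa using hI
    linarith
  | succ I ih =>
    by_cases h : l ≤ 4 * m * B ^ I
    · refine (ih h).trans ?_
      rw [Finset.sum_range_succ]
      have : 0 ≤ 2 * Real.log B * max 0 (1 - (J I : ℝ) / l) := by positivity
      linarith
    · push Not at h
      have h1 : ∀ i ∈ Finset.range (I + 1), (1 / 2 : ℝ) ≤ max 0 (1 - (J i : ℝ) / l) := by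
        intro i hi
        refine le_max_of_le_right ?_
        have h2 : B ^ i ≤ B ^ I := pow_le_pow_right₀ hB (by
          have := Finset.mem_range.1 hi
          omega)
        have h3 : (J i : ℝ) / l ≤ 1 / 2 := by
          rw [div_le_iff₀ hl]
          nlinarith [hJ i]
        linarith
      have h4 := Finset.card_nsmul_le_sum _ _ _ h1
      rw [Finset.card_range, nsmul_eq_mul] at h4
      have h5 : Real.log (2 + l / m) ≤ Real.log (6 * B ^ (I + 1)) := by
        refine Real.log_le_log (by positivity) ?_
        have h6 : l / m ≤ 4 * B ^ (I + 1) := by rw [div_le_iff₀ hm]; linarith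
        have h7 : 1 ≤ B ^ (I + 1) := one_le_pow₀ hB
        linarith
      rw [Real.log_mul (by norm_num) (by positivity), Real.log_pow] at h5
      nlinarith

lemma summable_log_moment {a : ℕ → ℝ} (ha : Antitone a) (hc : ∀ i, 0 ≤ secondDiff a i)
    (h0 : Tendsto a atTop (nhds 0)) {m B C₀ C₁ : ℝ} (hm : 0 < m) (hB : 2 ≤ B) (J : ℕ → ℕ)
    (hJ : ∀ i, (J i : ℝ) ≤ 2 * m * B ^ i) (haJ : ∀ i, a (J i) ≤ C₀ * (1 / 2) ^ i * a 0)
    (h1 : m * (a 0 - a 1) ≤ C₁ * a 0) :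
    Summable (fun i : ℕ => ((i : ℝ) + 1) * secondDiff a i *
      (1 + Real.log (2 + ((i : ℝ) + 1) / m) + m / ((i : ℝ) + 1))) ∧
    ∑' i : ℕ, ((i : ℝ) + 1) * secondDiff a i *
      (1 + Real.log (2 + ((i : ℝ) + 1) / m) + m / ((i : ℝ) + 1)) ≤
      (1 + Real.log 6 + 4 * C₀ * Real.log B + C₁) * a 0 := by
  have hpos : ∀ i, 0 ≤ a i := fun i => ha.le_of_tendsto h0 i
  have hlogB : 0 ≤ Real.log B := Real.log_nonneg (by linarith)
  have hlog : ∀ i : ℕ, 0 ≤ Real.log (2 + ((i : ℝ) + 1) / m) := fun i =>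
    Real.log_nonneg (by have : 0 ≤ ((i : ℝ) + 1) / m := by positivity
                        linarith)
  have hcp : ∀ i : ℕ, 0 ≤ ((i : ℝ) + 1) * secondDiff a i := fun i =>
    mul_nonneg (by positivity) (hc i)
  have hnn : ∀ i : ℕ, 0 ≤ ((i : ℝ) + 1) * secondDiff a i *
      (1 + Real.log (2 + ((i : ℝ) + 1) / m) + m / ((i : ℝ) + 1)) := fun i => by
    have := hcp i
    have := hlog i
    positivity
  have hbound : ∀ N : ℕ, ∑ i ∈ Finset.range N, ((i : ℝ) + 1) * secondDiff a i *
      (1 + Real.log (2 + ((i : ℝ) + 1) / m) + m / ((i : ℝ) + 1)) ≤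
      (1 + Real.log 6 + 4 * C₀ * Real.log B + C₁) * a 0 := by
    intro N
    obtain ⟨I, hI⟩ : ∃ I : ℕ, (N : ℝ) / (4 * m) < B ^ I := pow_unbounded_of_one_lt _ (by linarith)
    rw [div_lt_iff₀ (by positivity)] at hI
    have hterm : ∀ i ∈ Finset.range N, ((i : ℝ) + 1) * secondDiff a i *
        (1 + Real.log (2 + ((i : ℝ) + 1) / m) + m / ((i : ℝ) + 1)) ≤
        (1 + Real.log 6) * (((i : ℝ) + 1) * secondDiff a i) + 2 * Real.log B *
          ∑ r ∈ Finset.range I, ((i : ℝ) + 1) * secondDiff a i *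
            max 0 (1 - (J r : ℝ) / ((i : ℝ) + 1)) + m * secondDiff a i := by
      intro i hi
      have hi' : ((i : ℝ) + 1) ≤ N := by exact_mod_cast Finset.mem_range.1 hi
      have h2 := log_le_sum_tent hm (by linarith) J hJ I (l := (i : ℝ) + 1) (by positivity)
        (by linarith)
      have h3 := mul_le_mul_of_nonneg_left h2 (hcp i)
      rw [← Finset.mul_sum]
      have h4 : ((i : ℝ) + 1) * secondDiff a i * (m / ((i : ℝ) + 1)) = m * secondDiff a i := by
        field_simp
      linarith
    refine (Finset.sum_le_sum hterm).trans ?_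
    rw [Finset.sum_add_distrib, Finset.sum_add_distrib, ← Finset.mul_sum, ← Finset.mul_sum,
      ← Finset.mul_sum, Finset.sum_comm]
    have s1 : ∑ i ∈ Finset.range N, ((i : ℝ) + 1) * secondDiff a i ≤ a 0 :=
      sum_le_hasSum _ (fun i _ => hcp i) (hasSum_mul_secondDiff ha hc h0)
    have s2 : ∀ r, ∑ i ∈ Finset.range N, ((i : ℝ) + 1) * secondDiff a i *
        max 0 (1 - (J r : ℝ) / ((i : ℝ) + 1)) ≤ C₀ * (1 / 2) ^ r * a 0 := fun r =>
      (sum_le_hasSum _ (fun i _ => mul_nonneg (hcp i) (le_max_left _ _))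
        (hasSum_tent ha hc h0 (J r))).trans (haJ r)
    have s3 : ∑ r ∈ Finset.range I, ∑ i ∈ Finset.range N, ((i : ℝ) + 1) * secondDiff a i *
        max 0 (1 - (J r : ℝ) / ((i : ℝ) + 1)) ≤ 2 * (C₀ * a 0) := by
      refine (Finset.sum_le_sum fun r _ => s2 r).trans ?_
      have h5 : 0 ≤ C₀ * a 0 := by
        have := (hpos _).trans (haJ 0)
        simpa using this
      have h6 : ∑ r ∈ Finset.range I, (1 / 2 : ℝ) ^ r ≤ 2 :=
        sum_le_hasSum _ (fun i _ => by positivity) hasSum_geometric_two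
      calc ∑ r ∈ Finset.range I, C₀ * (1 / 2) ^ r * a 0
          = (∑ r ∈ Finset.range I, (1 / 2 : ℝ) ^ r) * (C₀ * a 0) := by
            rw [Finset.sum_mul]
            exact Finset.sum_congr rfl fun r _ => by ring
        _ ≤ _ := mul_le_mul_of_nonneg_right h6 h5
    have s4 : m * ∑ i ∈ Finset.range N, secondDiff a i ≤ C₁ * a 0 := by
      refine le_trans (mul_le_mul_of_nonneg_left ?_ hm.le) h1
      rw [sum_range_secondDiff]
      linarith [ha (Nat.le_succ N)]
    have h6 : 0 ≤ Real.log 6 := Real.log_nonneg (by norm_num)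
    nlinarith [mul_le_mul_of_nonneg_left s1 (by linarith : 0 ≤ 1 + Real.log 6),
      mul_le_mul_of_nonneg_left s3 (by linarith : 0 ≤ 2 * Real.log B)]
  exact ⟨summable_of_sum_range_le hnn hbound, Real.tsum_le_of_sum_range_le hnn hbound⟩

lemma MClass.antitoneOn {ψ : ℝ → ℝ} (h : MClass ψ) : AntitoneOn ψ (Set.Ici 1) := by
  obtain ⟨hpos, hconv, hlim⟩ := h
  intro x hx y hy hxy
  by_contra! hlt
  have hxy' : x < y := lt_of_le_of_ne hxy (by rintro rfl; exact lt_irrefl _ hlt)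
  have hge : ∀ z, y < z → ψ y ≤ ψ z := by
    intro z hz
    have h1 := hconv.slope_mono_adjacent hx (show z ∈ Set.Ici (1 : ℝ) from le_trans hy hz.le)
      hxy' hz
    have h2 : 0 < (ψ y - ψ x) / (y - x) := div_pos (by linarith) (by linarith)
    have h3 : 0 < (ψ z - ψ y) / (z - y) := h2.trans_le h1
    have := (div_pos_iff_of_pos_right (by linarith : 0 < z - y)).1 h3
    linarith
  have h0 : ψ y ≤ 0 := ge_of_tendsto hlim ((eventually_gt_atTop y).mono hge)
  exact absurd (hpos y hy) (not_lt.2 h0)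

lemma MClass.eta_spec {ψ : ℝ → ℝ} (h : MClass ψ) {t : ℝ} (ht : 1 < t) :
    t < eta ψ t ∧ ψ (eta ψ t) = ψ t / 2 := by
  have hanti := h.antitoneOn
  obtain ⟨hpos, hconv, hlim⟩ := h
  have htpos := hpos t ht.le
  obtain ⟨b, hb1, hb2⟩ : ∃ b, ψ b < ψ t / 2 ∧ t < b :=
    ((hlim.eventually (gt_mem_nhds (half_pos htpos))).and (eventually_gt_atTop t)).exists
  have hcont : ContinuousOn ψ (Set.Icc t b) := by
    refine (hconv.continuousOn_interior).mono fun x hx => ?_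
    rw [interior_Ici]
    exact ht.trans_le hx.1
  obtain ⟨s, hs, hs2⟩ := intermediate_value_Icc' hb2.le hcont
    (show ψ t / 2 ∈ Set.Icc (ψ b) (ψ t) from ⟨hb1.le, by linarith⟩)
  have hex : ∃ a ∈ Set.Ici (1 : ℝ), ψ a = ψ t / 2 := ⟨s, ht.le.trans hs.1, hs2⟩
  have hmem : 1 ≤ eta ψ t := Function.invFunOn_mem hex
  have heq : ψ (eta ψ t) = ψ t / 2 := Function.invFunOn_eq hex
  refine ⟨?_, heq⟩
  by_contra! hle
  have := hanti (show eta ψ t ∈ Set.Ici (1 : ℝ) from hmem) ht.le hle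
  linarith

lemma eta_sub_le {ψ : ℝ → ℝ} {K : ℝ}
    (hK : ∀ t ≥ (1 : ℝ), DifferentiableAt ℝ (eta ψ) t ∧ deriv (eta ψ) t ≤ K) {s t : ℝ}
    (hs : 1 ≤ s) (hst : s ≤ t) : eta ψ t - eta ψ s ≤ K * (t - s) := by
  refine (convex_Ici (1 : ℝ)).image_sub_le_mul_sub_of_deriv_le
    (fun x hx => (hK x hx).1.continuousAt.continuousWithinAt) ?_ ?_ s hs t (hs.trans hst) hst
  · intro x hx
    exact (hK x (interior_subset hx)).1.differentiableWithinAt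
  · intro x hx
    exact (hK x (interior_subset hx)).2

/-- The slope of `ψ` at `s` is controlled by `ψ s / (η(s) - s)`. -/
lemma eta_mul_sub_le {ψ : ℝ → ℝ} (h : MClass ψ) {K : ℝ} (hK0 : 0 ≤ K)
    (hK : ∀ t ≥ (1 : ℝ), DifferentiableAt ℝ (eta ψ) t ∧ deriv (eta ψ) t ≤ K) {s t : ℝ}
    (hs : 1 < s) (hst : s < t) : (eta ψ s - s) * (ψ s - ψ t) ≤ K * (t - s) * ψ s := by
  obtain ⟨hs1, hs2⟩ := h.eta_spec hs
  obtain ⟨ht1, ht2⟩ := h.eta_spec (hs.trans hst)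
  have hanti := h.antitoneOn
  have hψt : ψ t ≤ ψ s := hanti hs.le (hs.trans hst).le hst.le
  have hd := eta_sub_le hK hs.le hst.le
  have hTs : 0 < eta ψ s - s := by linarith
  have hψs := h.1 s hs.le
  rcases le_or_gt (eta ψ t) (eta ψ s) with hle | hlt
  · have h1 : ψ (eta ψ s) ≤ ψ (eta ψ t) :=
      hanti (show (1 : ℝ) ≤ eta ψ t by linarith) (show (1 : ℝ) ≤ eta ψ s by linarith) hle
    have h2 : ψ s = ψ t := by linarith
    rw [h2, sub_self, mul_zero]
    have := sub_pos.2 hst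
    have := h.1 t (hs.trans hst).le
    positivity
  · have h1 := h.2.1.slope_mono_adjacent (x := s) (y := eta ψ s) (z := eta ψ t) hs.le
      (show (1 : ℝ) ≤ eta ψ t by linarith) hs1 hlt
    rw [hs2, ht2, div_le_div_iff₀ hTs (by linarith)] at h1
    nlinarith [mul_le_mul_of_nonneg_right hd hψs.le]

lemma eta_iterate {ψ : ℝ → ℝ} (h : MClass ψ) {K : ℝ} (hK2 : 2 ≤ K)
    (hK : ∀ t ≥ (1 : ℝ), DifferentiableAt ℝ (eta ψ) t ∧ deriv (eta ψ) t ≤ K) (i : ℕ) :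
    ∀ s : ℝ, 1 < s → ψ (s + (eta ψ s - s) * K ^ i) ≤ (1 / 2) ^ i * ψ s := by
  have main : ∀ s : ℝ, 1 < s → 1 < (eta ψ)^[i] s ∧ ψ ((eta ψ)^[i] s) = (1 / 2) ^ i * ψ s ∧
      (eta ψ)^[i + 1] s - (eta ψ)^[i] s ≤ (eta ψ s - s) * K ^ i ∧
      (eta ψ)^[i] s ≤ s + (eta ψ s - s) * K ^ i := by
    induction i with
    | zero =>
      intro s hs
      have := (h.eta_spec hs).1
      simp [hs]
      linarith
    | succ i ih =>
      intro s hs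
      obtain ⟨h1, h2, h3, h4⟩ := ih s hs
      obtain ⟨h5, h6⟩ := h.eta_spec h1
      have hT := (h.eta_spec hs).1
      have h7 := eta_sub_le hK h1.le h5.le
      simp only [Function.iterate_succ_apply'] at h3 ⊢
      have h8 : 0 ≤ (eta ψ s - s) * K ^ i := by
        have : 0 ≤ eta ψ s - s := by linarith
        positivity
      refine ⟨h1.trans h5, ?_, ?_, ?_⟩
      · rw [h6, h2]; ring
      · rw [pow_succ]; nlinarith
      · rw [pow_succ]; nlinarith
  intro s hs
  obtain ⟨h1, h2, -, h4⟩ := main s hs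
  rw [← h2]
  exact h.antitoneOn (show (1 : ℝ) ≤ _ from h1.le) (show (1 : ℝ) ≤ _ by linarith) h4

lemma MClass.secondDiff_nonneg {ψ : ℝ → ℝ} (h : MClass ψ) {n : ℕ} (hn : 1 ≤ n) (i : ℕ) :
    0 ≤ secondDiff (fun j : ℕ => ψ ((n : ℝ) + j)) i := by
  have hn' : (1 : ℝ) ≤ n := by exact_mod_cast hn
  have hi : (0 : ℝ) ≤ i := Nat.cast_nonneg i
  have h1 := h.2.1.2 (show (n : ℝ) + i ∈ Set.Ici (1 : ℝ) by rw [Set.mem_Ici]; linarith)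
    (show (n : ℝ) + (i + 2) ∈ Set.Ici (1 : ℝ) by rw [Set.mem_Ici]; linarith)
    (show (0 : ℝ) ≤ 1 / 2 by norm_num) (show (0 : ℝ) ≤ 1 / 2 by norm_num) (by norm_num)
  simp only [smul_eq_mul] at h1
  rw [show 1 / 2 * ((n : ℝ) + i) + 1 / 2 * ((n : ℝ) + (i + 2)) = n + (i + 1) by ring] at h1
  simp only [secondDiff]
  push_cast
  linarith

lemma MClass.antitone_nat {ψ : ℝ → ℝ} (h : MClass ψ) {n : ℕ} (hn : 1 ≤ n) :
    Antitone fun j : ℕ => ψ ((n : ℝ) + j) := by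
  intro i j hij
  have hn' : (1 : ℝ) ≤ n := by exact_mod_cast hn
  have hi : (0 : ℝ) ≤ i := Nat.cast_nonneg i
  have hij' : (i : ℝ) ≤ j := by exact_mod_cast hij
  exact h.antitoneOn (show (1 : ℝ) ≤ _ by linarith) (show (1 : ℝ) ≤ _ by linarith) (by linarith)

lemma MClass.tendsto_nat {ψ : ℝ → ℝ} (h : MClass ψ) (n : ℕ) :
    Tendsto (fun j : ℕ => ψ ((n : ℝ) + j)) atTop (nhds 0) :=
  h.2.2.comp (tendsto_atTop_add_const_left _ _ tendsto_natCast_atTop_atTop)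

lemma ceil_le_two_mul {x : ℝ} (hx : 1 ≤ x) : (⌈x⌉₊ : ℝ) ≤ 2 * x := by
  have := Nat.ceil_lt_add_one (by linarith : 0 ≤ x)
  linarith

/-- For `ψ ∈ F` and `n ≥ 2`, the scale `min n (max 1 (η(n) - n))` governs the decay of `ψ`
to the right of `n`. -/
lemma scale_of_two_le {ψ : ℝ → ℝ} (h : MClass ψ) {K Q : ℝ} (hK2 : 2 ≤ K) (hQ : 1 ≤ Q)
    (hK : ∀ t ≥ (1 : ℝ), DifferentiableAt ℝ (eta ψ) t ∧ deriv (eta ψ) t ≤ K)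
    {n : ℕ} (hn : 2 ≤ n) (hQn : eta ψ n ≤ Q * n) {m : ℝ}
    (hm : m = min (n : ℝ) (max 1 (eta ψ n - n))) :
    (∀ i, ψ (n + (⌈m * (K * Q) ^ i⌉₊ : ℕ)) ≤ 2 * (1 / 2) ^ i * ψ n) ∧
      m * (ψ n - ψ (n + 1)) ≤ K * ψ n := by
  have hn' : (2 : ℝ) ≤ n := by exact_mod_cast hn
  have hT := (h.eta_spec (by linarith : (1 : ℝ) < n)).1
  have hψn := h.1 n (by linarith)
  have hanti := h.antitoneOn
  have hm1 : 1 ≤ m := hm ▸ le_min (by linarith) (le_max_left _ _)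
  have hQm : eta ψ n - n ≤ Q * m := by
    rw [hm]
    rcases le_total (n : ℝ) (max 1 (eta ψ n - n)) with h1 | h1
    · rw [min_eq_left h1]; linarith
    · rw [min_eq_right h1]
      have := le_max_right 1 (eta ψ n - n)
      nlinarith
  constructor
  · intro i
    cases i with
    | zero =>
      have : ψ (n + (⌈m * (K * Q) ^ 0⌉₊ : ℕ)) ≤ ψ n :=
        hanti (show (1 : ℝ) ≤ n by linarith) (show (1 : ℝ) ≤ (n : ℝ) + (⌈m * (K * Q) ^ 0⌉₊ : ℕ) by
            have := Nat.cast_nonneg (α := ℝ) ⌈m * (K * Q) ^ 0⌉₊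
            linarith)
          (by simp)
      simpa using this.trans (by linarith)
    | succ i =>
      have h1 := eta_iterate h hK2 hK i n (by linarith)
      have h2 : (eta ψ n - n) * K ^ i ≤ (⌈m * (K * Q) ^ (i + 1)⌉₊ : ℕ) := by
        refine le_trans ?_ (Nat.le_ceil _)
        have hQi : 1 ≤ Q ^ i := one_le_pow₀ hQ
        calc (eta ψ n - n) * K ^ i ≤ Q * m * K ^ i := by gcongr
          _ ≤ Q * m * K ^ i * (K * Q ^ i) := by
            refine le_mul_of_one_le_right (by positivity) ?_
            nlinarith
          _ = m * (K * Q) ^ (i + 1) := by rw [mul_pow, pow_succ, pow_succ]; ring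
      have h3 : 0 ≤ (eta ψ n - n) * K ^ i := by
        have : 0 ≤ eta ψ n - n := by linarith
        positivity
      refine (hanti (show (1 : ℝ) ≤ _ by linarith) (show (1 : ℝ) ≤ _ by linarith)
        (by linarith)).trans (h1.trans (le_of_eq ?_))
      rw [pow_succ]; ring
  · have h1 := eta_mul_sub_le h (by linarith) hK (by linarith : (1 : ℝ) < n)
      (by linarith : (n : ℝ) < n + 1)
    have hsucc : ψ (n + 1) ≤ ψ n := hanti (show (1 : ℝ) ≤ n by linarith)
      (show (1 : ℝ) ≤ n + 1 by linarith) (by linarith)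
    have hsucc0 := h.1 (n + 1) (by linarith)
    have h2 : m ≤ max 1 (eta ψ n - n) := hm ▸ min_le_right _ _
    refine (mul_le_mul_of_nonneg_right h2 (by linarith)).trans ?_
    rcases le_total 1 (eta ψ n - n) with h3 | h3
    · rw [max_eq_right h3]; linarith
    · rw [max_eq_left h3]; nlinarith

/-- The quantity `A_n^ψ`. -/
def logScale (ψ : ℝ → ℝ) (n : ℕ) : ℝ :=
  if eta ψ n - n ≤ 1 then Real.log n
  else if eta ψ n - n ≤ n then Real.log (n / (eta ψ n - n))
  else Real.log ((eta ψ n - n) / n)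

lemma abs_logScale_sub_le {ψ : ℝ → ℝ} {Q : ℝ} (hQ : 1 ≤ Q) {n : ℕ} (hn : 1 ≤ n)
    (hQn : eta ψ n ≤ Q * n) :
    |logScale ψ n - Real.log (n / min (n : ℝ) (max 1 (eta ψ n - n)))| ≤ Real.log Q := by
  have hn' : (1 : ℝ) ≤ n := by exact_mod_cast hn
  have hQ0 : 0 ≤ Real.log Q := Real.log_nonneg hQ
  rw [logScale]
  split_ifs with h1 h2
  · rw [max_eq_left h1, min_eq_right hn']
    simpa using hQ0
  · rw [max_eq_right (by linarith), min_eq_right h2]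
    simpa using hQ0
  · rw [max_eq_right (by linarith), min_eq_left (by linarith), div_self (by linarith),
      Real.log_one, sub_zero, abs_of_nonneg]
    · refine Real.log_le_log (div_pos (by linarith) (by linarith)) ?_
      rw [div_le_iff₀ (by linarith)]
      linarith
    · refine Real.log_nonneg ?_
      rw [le_div_iff₀ (by linarith)]
      linarith

/-- Uniform description of the decay of `ψ ∈ F` after each integer `n`. -/
lemma FClass.exists_scale {ψ : ℝ → ℝ} (hψ : FClass ψ) :
    ∃ B C₁ D : ℝ, 2 ≤ B ∧ ∀ n : ℕ, 1 ≤ n → ∃ m : ℝ, 1 ≤ m ∧ m ≤ n ∧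
      |logScale ψ n - Real.log (n / m)| ≤ D ∧ m * (ψ n - ψ (n + 1)) ≤ C₁ * ψ n ∧
      ∃ J : ℕ → ℕ, (∀ i, (J i : ℝ) ≤ 2 * m * B ^ i) ∧
        ∀ i, ψ (n + J i) ≤ 8 * (1 / 2) ^ i * ψ n := by
  obtain ⟨h, K₀, hK₀⟩ := hψ
  set K := max 2 K₀
  have hK2 : 2 ≤ K := le_max_left _ _
  have hK : ∀ t ≥ (1 : ℝ), DifferentiableAt ℝ (eta ψ) t ∧ deriv (eta ψ) t ≤ K := fun t ht =>
    ⟨(hK₀ t ht).1, (hK₀ t ht).2.trans (le_max_right _ _)⟩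
  have hη2 := (h.eta_spec (by norm_num : (1 : ℝ) < 2)).1
  set Q := eta ψ 2 + K
  have hQ : 1 ≤ Q := by linarith
  have hQn : ∀ n : ℕ, 2 ≤ n → eta ψ n ≤ Q * n := by
    intro n hn
    have hn' : (2 : ℝ) ≤ n := by exact_mod_cast hn
    have := eta_sub_le hK (by norm_num : (1 : ℝ) ≤ 2) hn'
    nlinarith
  have hanti := h.antitoneOn
  have hKQ : 2 ≤ K * Q := by nlinarith
  refine ⟨K * Q, K, max (Real.log Q) |logScale ψ 1|, hKQ, fun n hn => ?_⟩
  rcases Nat.lt_or_ge 1 n with hn2 | hn1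
  · have hn' : (2 : ℝ) ≤ n := by exact_mod_cast hn2
    have hm1 : 1 ≤ min (n : ℝ) (max 1 (eta ψ n - n)) := le_min (by linarith) (le_max_left _ _)
    obtain ⟨h1, h2⟩ := scale_of_two_le h hK2 hQ hK hn2 (hQn n hn2) rfl
    refine ⟨min (n : ℝ) (max 1 (eta ψ n - n)), hm1, min_le_left _ _,
      (abs_logScale_sub_le hQ hn (hQn n hn2)).trans (le_max_left _ _), h2, _, fun i => ?_,
      fun i => (h1 i).trans ?_⟩
    · have h3 : 1 ≤ (K * Q) ^ i := one_le_pow₀ (by linarith)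
      exact (ceil_le_two_mul (by nlinarith)).trans (by linarith)
    · have := h.1 n (by linarith)
      gcongr
      norm_num
  · obtain rfl : n = 1 := by omega
    have hψ1 := h.1 1 le_rfl
    have hψ2 := h.1 (1 + 1) (by norm_num)
    refine ⟨1, le_rfl, by simp, ?_, ?_, fun i => ⌈(K * Q) ^ i⌉₊, fun i => ?_, fun i => ?_⟩
    · simp
    · push_cast
      nlinarith
    · have h3 : 1 ≤ (K * Q) ^ i := one_le_pow₀ (by linarith)
      exact (ceil_le_two_mul h3).trans (by linarith)
    · obtain ⟨h1, -⟩ := scale_of_two_le h hK2 hQ hK le_rfl (hQn 2 le_rfl) rfl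
      set m := min ((2 : ℕ) : ℝ) (max 1 (eta ψ (2 : ℕ) - (2 : ℕ)))
      have hm2 : m ≤ 2 := (min_le_left _ _).trans (by norm_num)
      have hψ21 : ψ 2 ≤ ψ 1 := hanti (show (1 : ℝ) ≤ 1 from le_rfl)
        (show (1 : ℝ) ≤ 2 by norm_num) (by norm_num)
      have hle1 : ∀ j : ℕ, ψ (1 + j) ≤ ψ 1 := fun j =>
        hanti (show (1 : ℝ) ≤ 1 from le_rfl) (show (1 : ℝ) ≤ 1 + (j : ℝ) by
          have : (0 : ℝ) ≤ j := Nat.cast_nonneg j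
          linarith) (by simp)
      rcases i with _ | _ | i
      · have := hle1 ⌈(K * Q) ^ 0⌉₊
        push_cast at this ⊢
        linarith
      · have := hle1 ⌈(K * Q) ^ (0 + 1)⌉₊
        push_cast at this ⊢
        linarith
      · have h4 : (2 : ℕ) + (⌈m * (K * Q) ^ i⌉₊ : ℕ) ≤ 1 + (⌈(K * Q) ^ (i + 1 + 1)⌉₊ : ℕ) := by
          have h5 : ⌈m * (K * Q) ^ i⌉₊ + 1 ≤ ⌈(K * Q) ^ (i + 1 + 1)⌉₊ := by
            rw [Nat.add_one_le_iff, Nat.lt_ceil]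
            have h6 : 1 ≤ (K * Q) ^ i := one_le_pow₀ (by linarith)
            have hm0 : 1 ≤ m := le_min (by norm_num) (le_max_left _ _)
            have h7 := Nat.ceil_lt_add_one (by positivity : 0 ≤ m * (K * Q) ^ i)
            have h8 : 2 * (K * Q) ^ i ≤ (K * Q) ^ (i + 1) := by
              rw [pow_succ]; nlinarith
            have h9 : 2 * (K * Q) ^ (i + 1) ≤ (K * Q) ^ (i + 1 + 1) := by
              rw [pow_succ (K * Q) (i + 1)]; nlinarith
            nlinarith
          omega
        have h4' : ((2 : ℕ) : ℝ) + (⌈m * (K * Q) ^ i⌉₊ : ℕ) ≤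
            ((1 : ℕ) : ℝ) + (⌈(K * Q) ^ (i + 1 + 1)⌉₊ : ℕ) := by exact_mod_cast h4
        have h10 := hanti (show (1 : ℝ) ≤ ((2 : ℕ) : ℝ) + (⌈m * (K * Q) ^ i⌉₊ : ℕ) by
          push_cast
          have : (0 : ℝ) ≤ (⌈m * (K * Q) ^ i⌉₊ : ℕ) := Nat.cast_nonneg _
          linarith) (show (1 : ℝ) ≤ ((1 : ℕ) : ℝ) + (⌈(K * Q) ^ (i + 1 + 1)⌉₊ : ℕ) by simp) h4'
        refine h10.trans ((h1 i).trans ?_)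
        push_cast
        have : 2 * (1 / 2 : ℝ) ^ i = 8 * (1 / 2) ^ (i + 1 + 1) := by
          rw [pow_succ, pow_succ]; ring
        rw [this]
        gcongr

/-- Multipliers increasing linearly from `0` at `0` to `1` at `n`, then decreasing linearly to
`0` at `n + l`. -/
def tentMul (n l k : ℕ) : ℝ := if k < n then (k : ℝ) / n else max 0 (1 - ((k : ℝ) - n) / l)

/-- The kernel with multipliers `tentMul n l` and phase `γ`. -/
def tentKernel (n l : ℕ) (γ t : ℝ) : ℝ :=
  ∑ k ∈ Finset.range (n + l), tentMul n l k * Real.cos (k * t + γ)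

/-- The main part of the kernels `tentKernel n l γ` at scale `m`. -/
def mainKernel (n : ℕ) (m γ t : ℝ) : ℝ :=
  if 1 / (n : ℝ) ≤ |t| ∧ |t| ≤ 1 / m then Real.sin (n * t + γ) / t else 0

lemma sum_range_mul_cos (n : ℕ) (γ t : ℝ) :
    (∑ k ∈ Finset.range n, (k : ℝ) * Real.cos (k * t + γ)) * (2 - 2 * Real.cos t) =
      n * Real.cos (n * t + γ - t) - (n - 1) * Real.cos (n * t + γ) - Real.cos γ := by
  induction n with
  | zero => simp
  | succ n ih =>
    rw [Finset.sum_range_succ, add_mul, ih]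
    push_cast
    rw [show ((n : ℝ) + 1) * t + γ - t = n * t + γ by ring,
      show ((n : ℝ) + 1) * t + γ = n * t + γ + t by ring, Real.cos_sub,
      Real.cos_add (n * t + γ) t]
    ring

lemma sum_range_cos (l : ℕ) (x t : ℝ) :
    (∑ j ∈ Finset.range l, Real.cos (x + j * t)) * (2 - 2 * Real.cos t) =
      Real.cos x - Real.cos (x - t) + Real.cos (x + l * t - t) - Real.cos (x + l * t) := by
  induction l with
  | zero => simp
  | succ l ih =>
    rw [Finset.sum_range_succ, add_mul, ih]
    push_cast
    rw [show x + ((l : ℝ) + 1) * t - t = x + l * t by ring,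
      show x + ((l : ℝ) + 1) * t = x + l * t + t by ring, Real.cos_add (x + l * t) t,
      Real.cos_sub (x + l * t) t]
    ring

lemma sum_range_sub_mul_cos (l : ℕ) (x t : ℝ) :
    (∑ j ∈ Finset.range l, ((l : ℝ) - j) * Real.cos (x + j * t)) * (2 - 2 * Real.cos t) =
      (l + 1) * Real.cos x - l * Real.cos (x - t) - Real.cos (x + l * t) := by
  induction l with
  | zero => simp
  | succ l ih =>
    have h1 : ∑ j ∈ Finset.range (l + 1), (((l + 1 : ℕ) : ℝ) - j) * Real.cos (x + j * t) =
        ∑ j ∈ Finset.range l, ((l : ℝ) - j) * Real.cos (x + j * t) +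
          ∑ j ∈ Finset.range (l + 1), Real.cos (x + j * t) := by
      rw [Finset.sum_range_succ, Finset.sum_range_succ _ l, ← add_assoc, ← Finset.sum_add_distrib]
      congr 1
      · refine Finset.sum_congr rfl fun j _ => ?_
        push_cast
        ring
      · push_cast
        ring
    rw [h1, add_mul, ih, sum_range_cos]
    push_cast
    rw [show x + ((l : ℝ) + 1) * t - t = x + l * t by ring]
    ring

lemma tentKernel_eq {n l : ℕ} (hn : 1 ≤ n) (hl : 1 ≤ l) (γ t : ℝ) :
    tentKernel n l γ t = (1 / (n : ℝ)) * ∑ k ∈ Finset.range n, (k : ℝ) * Real.cos (k * t + γ) +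
      (1 / (l : ℝ)) * ∑ j ∈ Finset.range l, ((l : ℝ) - j) * Real.cos (n * t + γ + j * t) := by
  have hn' : (0 : ℝ) < n := by exact_mod_cast hn
  have hl' : (0 : ℝ) < l := by exact_mod_cast hl
  rw [tentKernel, Finset.sum_range_add, Finset.mul_sum, Finset.mul_sum]
  congr 1
  · refine Finset.sum_congr rfl fun k hk => ?_
    rw [tentMul, if_pos (Finset.mem_range.1 hk)]
    ring
  · refine Finset.sum_congr rfl fun j hj => ?_
    have hj' : (j : ℝ) ≤ l := by exact_mod_cast (Finset.mem_range.1 hj).le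
    rw [tentMul, if_neg (by omega)]
    push_cast
    rw [add_sub_cancel_left, max_eq_right (by rw [sub_nonneg, div_le_one hl']; exact hj'),
      show ((n : ℝ) + j) * t + γ = n * t + γ + j * t by ring]
    field_simp

lemma tentKernel_mul {n l : ℕ} (hn : 1 ≤ n) (hl : 1 ≤ l) (γ t : ℝ) :
    tentKernel n l γ t * (2 - 2 * Real.cos t) =
      (Real.cos (n * t + γ) - Real.cos γ) / n -
        (Real.cos (n * t + γ + l * t) - Real.cos (n * t + γ)) / l := by
  have hn' : (0 : ℝ) < n := by exact_mod_cast hn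
  have hl' : (0 : ℝ) < l := by exact_mod_cast hl
  rw [tentKernel_eq hn hl, add_mul, mul_assoc, mul_assoc, sum_range_mul_cos,
    sum_range_sub_mul_cos]
  field_simp
  ring

lemma abs_cos_add_sub_cos_le (x y : ℝ) : |Real.cos (x + y) - Real.cos x| ≤ |y| := by
  have := Real.abs_cos_sub_cos_le (x + y) x
  simpa using this

lemma abs_cos_add_sub_cos_add_mul_sin_le (x : ℝ) {y : ℝ} (hy : 0 ≤ y) :
    |Real.cos (x + y) - Real.cos x + y * Real.sin x| ≤ 5 * y ^ 2 / (1 + y) := by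
  have hsx := Real.abs_sin_le_one x
  have hcx := Real.abs_cos_le_one x
  have h1 : |Real.cos (x + y) - Real.cos x + y * Real.sin x| ≤ 2 * y := by
    refine (abs_add_le _ _).trans ?_
    have h2 := abs_cos_add_sub_cos_le x y
    rw [abs_of_nonneg hy] at h2
    rw [abs_mul, abs_of_nonneg hy]
    nlinarith
  have h2 : |Real.cos (x + y) - Real.cos x + y * Real.sin x| ≤ 5 / 2 * y ^ 2 := by
    have h3 : y - Real.sin y ≤ 2 * y ^ 2 := by
      rcases le_or_gt y 1 with h | h
      · rcases hy.eq_or_lt with rfl | h0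
        · simp
        · have := Real.sin_gt_sub_cube h0
          nlinarith [pow_pos h0 2]
      · have := Real.neg_one_le_sin y
        nlinarith
    have h4 : 0 ≤ y - Real.sin y := sub_nonneg.2 (Real.sin_le hy)
    have h5 := Real.one_sub_sq_div_two_le_cos (x := y)
    have h6 := Real.cos_le_one y
    rw [Real.cos_add, show Real.cos x * Real.cos y - Real.sin x * Real.sin y - Real.cos x +
      y * Real.sin x = -(Real.cos x * (1 - Real.cos y)) + Real.sin x * (y - Real.sin y) by ring]
    refine (abs_add_le _ _).trans ?_
    rw [abs_neg, abs_mul, abs_mul, abs_of_nonneg h4, abs_of_nonneg (by linarith : 0 ≤ 1 - Real.cos y)]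
    nlinarith
  rw [le_div_iff₀ (by linarith)]
  nlinarith

lemma two_fifths_mul_sq_le {t : ℝ} (ht : |t| ≤ π) : 2 / 5 * t ^ 2 ≤ 2 - 2 * Real.cos t := by
  have h1 := Real.cos_le_one_sub_mul_cos_sq ht
  have h2 : 1 / 5 ≤ 2 / π ^ 2 := by
    rw [div_le_div_iff₀ (by norm_num) (by positivity)]
    have := Real.pi_lt_d2
    nlinarith [Real.pi_pos]
  nlinarith [sq_nonneg t]

lemma abs_tentKernel_le (n l : ℕ) (γ t : ℝ) : |tentKernel n l γ t| ≤ n + l := by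
  have h1 : ∀ k, |tentMul n l k| ≤ 1 := by
    intro k
    rw [tentMul]
    split_ifs with h
    · rw [abs_of_nonneg (by positivity)]
      exact div_le_one_of_le₀ (by exact_mod_cast h.le) (by positivity)
    · have : (0 : ℝ) ≤ ((k : ℝ) - n) / l :=
        div_nonneg (sub_nonneg.2 (by exact_mod_cast not_lt.1 h)) (by positivity)
      rw [abs_of_nonneg (le_max_left _ _)]
      exact max_le zero_le_one (by linarith)
  refine (Finset.abs_sum_le_sum_abs _ _).trans ?_
  calc _ ≤ ∑ k ∈ Finset.range (n + l), (1 : ℝ) := Finset.sum_le_sum fun k _ => by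
        rw [abs_mul]
        exact mul_le_one₀ (h1 k) (abs_nonneg _) (Real.abs_cos_le_one _)
    _ = _ := by simp

section pointwise

variable {n l : ℕ} {t : ℝ}

lemma abs_tentKernel_mul_le (hn : 1 ≤ n) (hl : 1 ≤ l) (γ : ℝ) (ht : 0 < t) (htπ : t ≤ π)
    {c : ℝ} (hc : |(Real.cos (n * t + γ) - Real.cos γ) / n -
        (Real.cos (n * t + γ + l * t) - Real.cos (n * t + γ)) / l| ≤ c) :
    |tentKernel n l γ t| ≤ 5 / 2 * c / t ^ 2 := by
  have hs := two_fifths_mul_sq_le (abs_le.2 ⟨by linarith, htπ⟩)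
  have ht2 : 0 < t ^ 2 := by positivity
  rw [← tentKernel_mul hn hl, abs_mul, abs_of_nonneg (by linarith : 0 ≤ 2 - 2 * Real.cos t)] at hc
  rw [le_div_iff₀ ht2]
  nlinarith [mul_le_mul_of_nonneg_left hs (abs_nonneg (tentKernel n l γ t))]

lemma abs_tentKernel_le_inv (hn : 1 ≤ n) (hl : 1 ≤ l) (γ : ℝ) (ht : 0 < t) (htπ : t ≤ π) :
    |tentKernel n l γ t| ≤ 5 / t := by
  have hn' : (0 : ℝ) < n := by exact_mod_cast hn
  have hl' : (0 : ℝ) < l := by exact_mod_cast hl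
  refine (abs_tentKernel_mul_le hn hl γ ht htπ (c := 2 * t) ?_).trans (le_of_eq ?_)
  · have h1 := abs_cos_add_sub_cos_le γ (n * t)
    have h2 := abs_cos_add_sub_cos_le (n * t + γ) (l * t)
    rw [abs_of_nonneg (by positivity : 0 ≤ (n : ℝ) * t), add_comm γ] at h1
    rw [abs_of_nonneg (by positivity : 0 ≤ (l : ℝ) * t)] at h2
    refine (abs_sub _ _).trans ?_
    rw [abs_div, abs_div, abs_of_pos hn', abs_of_pos hl']
    have h3 : |Real.cos (n * t + γ) - Real.cos γ| / n ≤ t := by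
      rw [div_le_iff₀ hn']; linarith
    have h4 : |Real.cos (n * t + γ + l * t) - Real.cos (n * t + γ)| / l ≤ t := by
      rw [div_le_iff₀ hl']; linarith
    linarith
  · field_simp

lemma abs_cos_sub_cos_le_two (x y : ℝ) : |Real.cos x - Real.cos y| ≤ 2 := by
  refine (abs_sub _ _).trans ?_
  linarith [Real.abs_cos_le_one x, Real.abs_cos_le_one y]

lemma abs_tentKernel_le_inv_sq (hn : 1 ≤ n) (hl : 1 ≤ l) (γ : ℝ) (ht : 0 < t) (htπ : t ≤ π) :
    |tentKernel n l γ t| ≤ 5 * (1 / n + 1 / l) * (1 / t ^ 2) := by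
  have hn' : (0 : ℝ) < n := by exact_mod_cast hn
  have hl' : (0 : ℝ) < l := by exact_mod_cast hl
  refine (abs_tentKernel_mul_le hn hl γ ht htπ (c := 2 / n + 2 / l) ?_).trans (le_of_eq ?_)
  · refine (abs_sub _ _).trans ?_
    rw [abs_div, abs_div, abs_of_pos hn', abs_of_pos hl']
    gcongr <;> exact abs_cos_sub_cos_le_two _ _
  · field_simp

lemma abs_tentKernel_le_log_deriv (hn : 1 ≤ n) (hl : 1 ≤ l) (γ : ℝ) (ht : 0 ≤ t) (htπ : t ≤ π) :
    |tentKernel n l γ t| ≤ 6 * ((n + l : ℝ) / (1 + (n + l : ℝ) * t)) := by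
  have hn' : (0 : ℝ) < n := by exact_mod_cast hn
  have h1 := abs_tentKernel_le n l γ t
  have h2 : |tentKernel n l γ t| * t ≤ 5 := by
    rcases ht.eq_or_lt with rfl | h0
    · simp
    · have := abs_tentKernel_le_inv hn hl γ h0 htπ
      rwa [le_div_iff₀ h0] at this
  rw [← mul_div_assoc, le_div_iff₀ (by positivity)]
  have h3 : (0 : ℝ) ≤ n + l := by positivity
  nlinarith

lemma abs_tentKernel_sub_le (hn : 1 ≤ n) (hl : 1 ≤ l) (γ : ℝ) (ht : 0 < t) (ht1 : t ≤ 1) :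
    |tentKernel n l γ t - Real.sin (n * t + γ) / t| ≤
      5 / n * (1 / t ^ 2) + 1 + 25 / 2 * ((l : ℝ) / (1 + l * t)) := by
  have hn' : (0 : ℝ) < n := by exact_mod_cast hn
  have hl' : (0 : ℝ) < l := by exact_mod_cast hl
  have hs := two_fifths_mul_sq_le (t := t) (by
    rw [abs_of_pos ht]
    linarith [Real.pi_gt_three])
  set s := 2 - 2 * Real.cos t with hs_def
  have ht2 : 0 < t ^ 2 := by positivity
  have hs0 : 0 < s := by linarith
  have hE := abs_cos_add_sub_cos_add_mul_sin_le (n * t + γ) (by positivity : 0 ≤ (l : ℝ) * t)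
  set E := Real.cos (n * t + γ + l * t) - Real.cos (n * t + γ) + l * t * Real.sin (n * t + γ)
    with hE_def
  have hP := abs_cos_sub_cos_le_two (n * t + γ) γ
  set P := Real.cos (n * t + γ) - Real.cos γ with hP_def
  have hV : tentKernel n l γ t = (P / n - (E - l * t * Real.sin (n * t + γ)) / l) / s := by
    rw [eq_div_iff hs0.ne', hs_def, tentKernel_mul hn hl]
    congr 2
    rw [hE_def]
    ring
  have hid : tentKernel n l γ t - Real.sin (n * t + γ) / t =
      P / (n * s) + (t ^ 2 - s) / (s * t) * Real.sin (n * t + γ) - E / (l * s) := by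
    rw [hV]
    field_simp
    ring
  have b1 : |P / (n * s)| ≤ 5 / n * (1 / t ^ 2) := by
    rw [abs_div, abs_of_pos (by positivity : 0 < n * s), div_le_iff₀ (by positivity)]
    have : 2 ≤ 5 * (1 / t ^ 2) * s := by
      rw [mul_one_div, div_mul_eq_mul_div, le_div_iff₀ ht2]
      linarith
    calc |P| ≤ 2 := hP
      _ ≤ _ := this
      _ = _ := by field_simp
  have b2 : |(t ^ 2 - s) / (s * t) * Real.sin (n * t + γ)| ≤ 1 := by
    rw [abs_mul]
    refine mul_le_one₀ ?_ (abs_nonneg _) (Real.abs_sin_le_one _)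
    rw [abs_div, abs_of_pos (by positivity : 0 < s * t), div_le_one (by positivity)]
    have hc := Real.cos_bound (x := t) (by rwa [abs_of_pos ht])
    rw [abs_of_pos ht] at hc
    have h1 : |t ^ 2 - s| ≤ t ^ 4 * (5 / 48) := by
      rw [hs_def, show t ^ 2 - (2 - 2 * Real.cos t) = 2 * (Real.cos t - (1 - t ^ 2 / 2)) by ring,
        abs_mul, abs_two]
      linarith
    have h2 : 2 / 5 * t ^ 2 * t ≤ s * t := mul_le_mul_of_nonneg_right hs ht.le
    have h3 : t ^ 4 ≤ t ^ 3 := pow_le_pow_of_le_one ht.le ht1 (by norm_num)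
    nlinarith [pow_pos ht 3]
  have b3 : |E / (l * s)| ≤ 25 / 2 * ((l : ℝ) / (1 + l * t)) := by
    rw [abs_div, abs_of_pos (by positivity : 0 < l * s), div_le_iff₀ (by positivity)]
    refine hE.trans ?_
    rw [mul_div_assoc', div_mul_eq_mul_div]
    refine div_le_div_of_nonneg_right ?_ (by positivity)
    nlinarith [mul_le_mul_of_nonneg_left hs (by positivity : 0 ≤ 25 / 2 * (l : ℝ) ^ 2)]
  rw [hid]
  exact (abs_sub _ _).trans (add_le_add ((abs_add_le _ _).trans (add_le_add b1 b2)) b3)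

end pointwise

lemma continuous_tentKernel (n l : ℕ) (γ : ℝ) : Continuous (tentKernel n l γ) := by
  unfold tentKernel
  fun_prop

lemma measurable_mainKernel (n : ℕ) (m γ : ℝ) : Measurable (mainKernel n m γ) := by
  unfold mainKernel
  refine Measurable.ite ?_ (by fun_prop) measurable_const
  exact (measurableSet_le measurable_const measurable_norm).inter
    (measurableSet_le measurable_norm measurable_const)

lemma abs_mainKernel_le {n : ℕ} (hn : 1 ≤ n) (m γ t : ℝ) : |mainKernel n m γ t| ≤ n := by
  have hn' : (0 : ℝ) < n := by exact_mod_cast hn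
  rw [mainKernel]
  split_ifs with h
  · have ht : 0 < |t| := (by positivity : 0 < 1 / (n : ℝ)).trans_le h.1
    rw [abs_div, div_le_iff₀ ht]
    have h1 := h.1
    rw [div_le_iff₀ hn'] at h1
    linarith [Real.abs_sin_le_one (n * t + γ)]
  · simp

lemma intervalIntegrable_of_bounded {f : ℝ → ℝ} (hf : Measurable f) {c : ℝ}
    (hc : ∀ᵐ t ∂(volume : Measure ℝ), |f t| ≤ c) (a b : ℝ) : IntervalIntegrable f volume a b :=
  (intervalIntegrable_const (c := c)).mono_fun hf.aestronglyMeasurable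
    (ae_restrict_of_ae (hc.mono fun _ ht => ht.trans (le_abs_self c)))

lemma intervalIntegrable_mainKernel {n : ℕ} (hn : 1 ≤ n) (m γ a b : ℝ) :
    IntervalIntegrable (mainKernel n m γ) volume a b :=
  intervalIntegrable_of_bounded (measurable_mainKernel n m γ)
    (Eventually.of_forall (abs_mainKernel_le hn m γ)) a b

lemma integral_one_div_sq {a b : ℝ} (ha : 0 < a) (hab : a ≤ b) :
    ∫ t in a..b, 1 / t ^ 2 = 1 / a - 1 / b := by
  have hne : ∀ x ∈ Set.uIcc a b, x ≠ 0 := fun x hx => by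
    rw [Set.uIcc_of_le hab] at hx
    exact (ha.trans_le hx.1).ne'
  rw [intervalIntegral.integral_eq_sub_of_hasDerivAt (f := fun t => -(1 / t))]
  · ring
  · intro x hx
    have := (hasDerivAt_inv (hne x hx)).fun_neg
    simpa [one_div] using this
  · exact ContinuousOn.intervalIntegrable fun x hx =>
      (continuousAt_const.div (continuousAt_id.pow 2) (pow_ne_zero 2 (hne x hx))).continuousWithinAt

lemma continuousOn_log_deriv {a b A : ℝ} (ha : 0 ≤ a) (hab : a ≤ b) (hA : 0 ≤ A) :
    ContinuousOn (fun t => A / (1 + A * t)) (Set.uIcc a b) := fun x hx => by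
  rw [Set.uIcc_of_le hab] at hx
  have hx0 : 0 ≤ x := ha.trans hx.1
  exact (continuousAt_const.div (by fun_prop) (by positivity)).continuousWithinAt

lemma integral_log_deriv {a b A : ℝ} (ha : 0 ≤ a) (hab : a ≤ b) (hA : 0 ≤ A) :
    ∫ t in a..b, A / (1 + A * t) = Real.log (1 + A * b) - Real.log (1 + A * a) := by
  rw [intervalIntegral.integral_eq_sub_of_hasDerivAt (f := fun t => Real.log (1 + A * t))]
  · intro x hx
    rw [Set.uIcc_of_le hab] at hx
    have hx0 : 0 ≤ x := ha.trans hx.1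
    have h1 : HasDerivAt (fun t => 1 + A * t) A x := by
      simpa using ((hasDerivAt_id x).const_mul A).const_add 1
    exact h1.log (by positivity)
  · exact (continuousOn_log_deriv ha hab hA).intervalIntegrable

lemma integral_abs_tentKernel_sub_pos_le {n l : ℕ} (hn : 1 ≤ n) (hl : 1 ≤ l) {m : ℝ}
    (hm1 : 1 ≤ m) (hmn : m ≤ n) (γ : ℝ) :
    ∫ t in (0 : ℝ)..π, |tentKernel n l γ t - mainKernel n m γ t| ≤
      19 * (1 + Real.log (2 + l / m) + m / l) := by
  have hn' : (0 : ℝ) < n := by exact_mod_cast hn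
  have hl' : (0 : ℝ) < l := by exact_mod_cast hl
  have hm0 : 0 < m := by linarith
  have hπ := Real.pi_gt_three
  have h1n : 0 < 1 / (n : ℝ) := by positivity
  have h1m : 1 / (n : ℝ) ≤ 1 / m := one_div_le_one_div_of_le hm0 hmn
  have h1m1 : 1 / m ≤ 1 := by rw [div_le_one hm0]; exact hm1
  have hint : ∀ a b, IntervalIntegrable (fun t => |tentKernel n l γ t - mainKernel n m γ t|)
      volume a b := fun a b =>
    (((continuous_tentKernel n l γ).intervalIntegrable a b).sub
      (intervalIntegrable_mainKernel hn m γ a b)).abs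
  rw [← intervalIntegral.integral_add_adjacent_intervals (hint 0 (1 / n)) (hint _ _),
    ← intervalIntegral.integral_add_adjacent_intervals (hint (1 / n) (1 / m)) (hint _ _)]
  have hL : 0 ≤ Real.log (2 + l / m) := Real.log_nonneg (by
    have : 0 ≤ (l : ℝ) / m := by positivity
    linarith)
  have i1 : ∫ t in (0 : ℝ)..(1 / n), |tentKernel n l γ t - mainKernel n m γ t| ≤
      6 * Real.log (2 + l / m) := by
    have hA : (0 : ℝ) ≤ n + l := by positivity
    have e1 := integral_log_deriv le_rfl h1n.le hA
    calc _ ≤ ∫ t in (0 : ℝ)..(1 / n), 6 * ((n + l : ℝ) / (1 + (n + l : ℝ) * t)) := by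
          refine intervalIntegral.integral_mono_on_of_le_Ioo h1n.le (hint _ _)
            ((continuousOn_log_deriv le_rfl h1n.le hA).intervalIntegrable.const_mul 6) ?_
          intro t ht
          rw [mainKernel, if_neg (by rw [abs_of_pos ht.1]; exact fun h => absurd h.1 (not_le.2 ht.2)),
            sub_zero]
          exact abs_tentKernel_le_log_deriv hn hl γ ht.1.le (by linarith [ht.2])
      _ = 6 * Real.log (2 + l / n) := by
          rw [intervalIntegral.integral_const_mul, e1]
          rw [mul_zero, add_zero, Real.log_one, sub_zero]
          congr 2
          field_simp
          ring
      _ ≤ _ := by gcongr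
  have i2 : ∫ t in (1 / (n : ℝ))..(1 / m), |tentKernel n l γ t - mainKernel n m γ t| ≤
      6 + 25 / 2 * Real.log (2 + l / m) := by
    have hsq : IntervalIntegrable (fun t : ℝ => 1 / t ^ 2) volume (1 / (n : ℝ)) (1 / m) :=
      ContinuousOn.intervalIntegrable fun x hx => by
        rw [Set.uIcc_of_le h1m] at hx
        exact (continuousAt_const.div (continuousAt_id.pow 2)
          (pow_ne_zero 2 (h1n.trans_le hx.1).ne')).continuousWithinAt
    have hlg := (continuousOn_log_deriv h1n.le h1m hl'.le).intervalIntegrable (μ := volume)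
    have hcst : IntervalIntegrable (fun _ : ℝ => (1 : ℝ)) volume (1 / (n : ℝ)) (1 / m) :=
      intervalIntegrable_const
    calc _ ≤ ∫ t in (1 / (n : ℝ))..(1 / m),
          (5 / n * (1 / t ^ 2) + 1 + 25 / 2 * ((l : ℝ) / (1 + l * t))) := by
          refine intervalIntegral.integral_mono_on h1m (hint _ _)
            (((hsq.const_mul _).add hcst).add (hlg.const_mul _)) ?_
          intro t ht
          have ht0 : 0 < t := h1n.trans_le ht.1
          rw [mainKernel, if_pos (by rw [abs_of_pos ht0]; exact ht)]
          exact abs_tentKernel_sub_le hn hl γ ht0 (ht.2.trans h1m1)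
      _ = 5 / n * (n - m) + (1 / m - 1 / n) +
          25 / 2 * (Real.log (1 + l / m) - Real.log (1 + l / n)) := by
          rw [intervalIntegral.integral_add ((hsq.const_mul _).add hcst) (hlg.const_mul _),
            intervalIntegral.integral_add (hsq.const_mul _) hcst,
            intervalIntegral.integral_const_mul, intervalIntegral.integral_const_mul,
            integral_one_div_sq h1n h1m, integral_log_deriv h1n.le h1m hl'.le]
          simp
          ring_nf
      _ ≤ _ := by
          have e1 : 5 / (n : ℝ) * (n - m) ≤ 5 := by
            rw [div_mul_eq_mul_div, div_le_iff₀ hn']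
            nlinarith
          have e2 : Real.log (1 + l / m) ≤ Real.log (2 + l / m) :=
            Real.log_le_log (by positivity) (by linarith)
          have e3 : 0 ≤ Real.log (1 + l / n) := Real.log_nonneg (by
            have : 0 ≤ (l : ℝ) / n := by positivity
            linarith)
          linarith
  have i3 : ∫ t in (1 / m)..π, |tentKernel n l γ t - mainKernel n m γ t| ≤ 5 + 5 * (m / l) := by
    have h1m0 : 0 < 1 / m := by positivity
    have hmπ : 1 / m ≤ π := by linarith
    have hsq : IntervalIntegrable (fun t : ℝ => 1 / t ^ 2) volume (1 / m) π :=
      ContinuousOn.intervalIntegrable fun x hx => by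
        rw [Set.uIcc_of_le hmπ] at hx
        exact (continuousAt_const.div (continuousAt_id.pow 2)
          (pow_ne_zero 2 (h1m0.trans_le hx.1).ne')).continuousWithinAt
    calc _ ≤ ∫ t in (1 / m)..π, 5 * (1 / (n : ℝ) + 1 / l) * (1 / t ^ 2) := by
          refine intervalIntegral.integral_mono_on_of_le_Ioo hmπ (hint _ _) (hsq.const_mul _) ?_
          intro t ht
          have ht0 : 0 < t := h1m0.trans ht.1
          rw [mainKernel, if_neg (by rw [abs_of_pos ht0]; exact fun h => absurd h.2 (not_le.2 ht.1)),
            sub_zero]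
          exact abs_tentKernel_le_inv_sq hn hl γ ht0 ht.2.le
      _ = 5 * (1 / (n : ℝ) + 1 / l) * (m - 1 / π) := by
          rw [intervalIntegral.integral_const_mul, integral_one_div_sq h1m0 hmπ, one_div_one_div]
      _ ≤ 5 * (1 / (n : ℝ) + 1 / l) * m := by
          gcongr
          have : 0 < 1 / π := by positivity
          linarith
      _ = 5 * (m / n) + 5 * (m / l) := by ring
      _ ≤ _ := by
          have : m / n ≤ 1 := by rw [div_le_one hn']; exact hmn
          linarith
  have : 0 ≤ m / l := by positivity
  linarith

lemma tentKernel_neg (n l : ℕ) (γ t : ℝ) : tentKernel n l γ (-t) = tentKernel n l (-γ) t := by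
  unfold tentKernel
  refine Finset.sum_congr rfl fun k _ => ?_
  rw [← Real.cos_neg]
  congr 2
  ring

lemma mainKernel_neg (n : ℕ) (m γ t : ℝ) : mainKernel n m γ (-t) = mainKernel n m (-γ) t := by
  unfold mainKernel
  rw [abs_neg]
  congr 1
  rw [show (n : ℝ) * -t + γ = -(n * t + -γ) by ring, Real.sin_neg, neg_div_neg_eq]

lemma integral_eq_integral_pos_add {f : ℝ → ℝ} (hf : ∀ a b, IntervalIntegrable f volume a b) :
    ∫ t in (-π)..π, f t = (∫ t in (0 : ℝ)..π, f (-t)) + ∫ t in (0 : ℝ)..π, f t := by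
  rw [intervalIntegral.integral_comp_neg, neg_zero,
    intervalIntegral.integral_add_adjacent_intervals (hf _ _) (hf _ _)]

/-- The tent kernels differ from their main part by an integrable error. -/
lemma integral_abs_tentKernel_sub_le {n l : ℕ} (hn : 1 ≤ n) (hl : 1 ≤ l) {m : ℝ}
    (hm1 : 1 ≤ m) (hmn : m ≤ n) (γ : ℝ) :
    ∫ t in (-π)..π, |tentKernel n l γ t - mainKernel n m γ t| ≤
      38 * (1 + Real.log (2 + l / m) + m / l) := by
  rw [integral_eq_integral_pos_add fun a b =>
    (((continuous_tentKernel n l γ).intervalIntegrable a b).sub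
      (intervalIntegrable_mainKernel hn m γ a b)).abs]
  simp_rw [tentKernel_neg, mainKernel_neg]
  linarith [integral_abs_tentKernel_sub_pos_le hn hl hm1 hmn γ,
    integral_abs_tentKernel_sub_pos_le hn hl hm1 hmn (-γ)]

lemma integral_abs_sin_period (a : ℝ) : ∫ t in a..(a + π), |Real.sin t| = 2 := by
  have hper : Function.Periodic (fun t => |Real.sin t|) π := fun t => by
    simp only [Real.sin_add_pi, abs_neg]
  rw [hper.intervalIntegral_add_eq a 0, zero_add]
  rw [intervalIntegral.integral_congr (g := Real.sin)]
  · rw [integral_sin]; norm_num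
  · intro t ht
    rw [Set.uIcc_of_le Real.pi_pos.le] at ht
    exact abs_of_nonneg (Real.sin_nonneg_of_nonneg_of_le_pi ht.1 ht.2)

lemma abs_integral_abs_sin_sub_le (γ a u : ℝ) :
    |∫ v in a..u, (|Real.sin (v + γ)| - 2 / π)| ≤ π := by
  have hc : Continuous fun v => |Real.sin (v + γ)| - 2 / π := by fun_prop
  have hper : Function.Periodic (fun u => ∫ v in a..u, (|Real.sin (v + γ)| - 2 / π)) π := by
    intro u
    simp only
    rw [← intervalIntegral.integral_add_adjacent_intervals (hc.intervalIntegrable a u)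
      (hc.intervalIntegrable u (u + π))]
    have : ∫ v in u..(u + π), (|Real.sin (v + γ)| - 2 / π) = 0 := by
      rw [intervalIntegral.integral_sub (Continuous.intervalIntegrable (by fun_prop) _ _)
        intervalIntegrable_const,
        intervalIntegral.integral_comp_add_right (fun v => |Real.sin v|),
        show u + π + γ = u + γ + π by ring, integral_abs_sin_period]
      simp only [intervalIntegral.integral_const, add_sub_cancel_left, smul_eq_mul]
      field_simp
      ring
    rw [this, add_zero]
  obtain ⟨y, hy, hyu⟩ := hper.exists_mem_Ico Real.pi_pos u a
  rw [hyu]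
  have hb := intervalIntegral.norm_integral_le_of_norm_le_const (a := a) (b := y) (C := 1)
    (f := fun v => |Real.sin (v + γ)| - 2 / π) (fun v _ => by
      have h1 := Real.abs_sin_le_one (v + γ)
      have h2 : 0 ≤ |Real.sin (v + γ)| := abs_nonneg _
      have h3 : 0 < 2 / π := by positivity
      have h4 : 2 / π ≤ 1 := by
        rw [div_le_one Real.pi_pos]
        linarith [Real.pi_gt_three]
      rw [Real.norm_eq_abs, abs_le]
      constructor <;> linarith)
  rw [Real.norm_eq_abs, one_mul, abs_of_nonneg (sub_nonneg.2 hy.1)] at hb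
  linarith [hy.2]

lemma abs_integral_abs_sin_div_sub_le (γ : ℝ) {X : ℝ} (hX : 1 ≤ X) :
    |(∫ u in (1 : ℝ)..X, |Real.sin (u + γ)| / u) - 2 / π * Real.log X| ≤ π := by
  have hne : ∀ x ∈ Set.uIcc 1 X, 0 < x := fun x hx => by
    rw [Set.uIcc_of_le hX] at hx
    linarith [hx.1]
  set H : ℝ → ℝ := fun u => ∫ v in (1 : ℝ)..u, (|Real.sin (v + γ)| - 2 / π) with hH
  have hc : Continuous fun v => |Real.sin (v + γ)| - 2 / π := by fun_prop
  have hHd : ∀ x, HasDerivAt H (|Real.sin (x + γ)| - 2 / π) x := fun x =>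
    intervalIntegral.integral_hasDerivAt_right (hc.intervalIntegrable _ _)
      (hc.stronglyMeasurableAtFilter _ _) hc.continuousAt
  have hHc : Continuous H := continuous_iff_continuousAt.2 fun x => (hHd x).continuousAt
  have hinv : IntervalIntegrable (fun x : ℝ => 1 / x) volume 1 X :=
    ContinuousOn.intervalIntegrable fun x hx =>
      (continuousAt_const.div continuousAt_id (hne x hx).ne').continuousWithinAt
  have hsq : IntervalIntegrable (fun t : ℝ => 1 / t ^ 2) volume 1 X :=
    ContinuousOn.intervalIntegrable fun x hx =>
      (continuousAt_const.div (continuousAt_id.pow 2)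
          (pow_ne_zero 2 (hne x hx).ne')).continuousWithinAt
  have hsd : IntervalIntegrable (fun x : ℝ => |Real.sin (x + γ)| / x) volume 1 X :=
    ContinuousOn.intervalIntegrable fun x hx =>
      (ContinuousAt.div (by fun_prop) continuousAt_id (hne x hx).ne').continuousWithinAt
  have hparts := intervalIntegral.integral_mul_deriv_eq_deriv_mul (a := 1) (b := X)
    (u := fun x => 1 / x) (v := H) (u' := fun x => -(1 / x ^ 2))
    (v' := fun x => |Real.sin (x + γ)| - 2 / π)
    (fun x hx => by simpa [one_div] using hasDerivAt_inv (hne x hx).ne') (fun x _ => hHd x)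
    hsq.neg (hc.intervalIntegrable _ _)
  have hL : ∫ x in (1 : ℝ)..X, 1 / x * (|Real.sin (x + γ)| - 2 / π) =
      (∫ u in (1 : ℝ)..X, |Real.sin (u + γ)| / u) - 2 / π * Real.log X := by
    have h1 : ∫ x in (1 : ℝ)..X, 1 / x = Real.log X := by
      rw [integral_one_div_of_pos one_pos (by linarith), div_one]
    rw [← h1, ← intervalIntegral.integral_const_mul, ← intervalIntegral.integral_sub hsd
      (hinv.const_mul _)]
    refine intervalIntegral.integral_congr fun x _ => ?_
    ring
  rw [← hL, hparts]
  have h1 : H 1 = 0 := intervalIntegral.integral_same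
  have hX0 : 0 < X := by linarith
  have hb1 : |1 / X * H X| ≤ π * (1 / X) := by
    rw [abs_mul, abs_of_pos (by positivity : 0 < 1 / X), mul_comm]
    exact mul_le_mul_of_nonneg_right (abs_integral_abs_sin_sub_le γ 1 X) (by positivity)
  have hb2 : |∫ x in (1 : ℝ)..X, -(1 / x ^ 2) * H x| ≤ π * (1 - 1 / X) := by
    calc _ = ‖∫ x in (1 : ℝ)..X, -(1 / x ^ 2) * H x‖ := rfl
      _ ≤ ∫ x in (1 : ℝ)..X, π * (1 / x ^ 2) := by
          refine intervalIntegral.norm_integral_le_of_norm_le hX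
            (Eventually.of_forall fun x hx => ?_) (hsq.const_mul _)
          have hx0 : 0 < x := by linarith [hx.1]
          rw [norm_mul, norm_neg, Real.norm_of_nonneg (by positivity : 0 ≤ 1 / x ^ 2), mul_comm]
          exact mul_le_mul_of_nonneg_right (abs_integral_abs_sin_sub_le γ 1 x) (by positivity)
      _ = _ := by
          rw [intervalIntegral.integral_const_mul, integral_one_div_sq one_pos hX, div_one]
  rw [h1, mul_zero, sub_zero]
  calc _ ≤ |1 / X * H X| + |∫ x in (1 : ℝ)..X, -(1 / x ^ 2) * H x| := abs_sub _ _
    _ ≤ π := by linarith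

lemma integral_abs_mainKernel_pos {n : ℕ} (hn : 1 ≤ n) {m : ℝ} (hm1 : 1 ≤ m) (hmn : m ≤ n)
    (γ : ℝ) : ∫ t in (0 : ℝ)..π, |mainKernel n m γ t| =
      ∫ u in (1 : ℝ)..(n / m), |Real.sin (u + γ)| / u := by
  have hn' : (0 : ℝ) < n := by exact_mod_cast hn
  have hm0 : 0 < m := by linarith
  have hπ := Real.pi_gt_three
  have h1n : 0 < 1 / (n : ℝ) := by positivity
  have h1m : 1 / (n : ℝ) ≤ 1 / m := one_div_le_one_div_of_le hm0 hmn
  have h1m1 : 1 / m ≤ 1 := by rw [div_le_one hm0]; exact hm1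
  have hint : ∀ a b, IntervalIntegrable (fun t => |mainKernel n m γ t|) volume a b :=
    fun a b => (intervalIntegrable_mainKernel hn m γ a b).abs
  have z1 : ∫ t in (0 : ℝ)..(1 / n), |mainKernel n m γ t| = 0 := by
    rw [intervalIntegral.integral_congr_Ioo_of_le h1n.le (g := fun _ => 0)]
    · simp
    · intro t ht
      simp only
      rw [mainKernel, if_neg (by rw [abs_of_pos ht.1]; exact fun h => absurd h.1 (not_le.2 ht.2)),
        abs_zero]
  have z2 : ∫ t in (1 / m)..π, |mainKernel n m γ t| = 0 := by
    rw [intervalIntegral.integral_congr_Ioo_of_le (by linarith) (g := fun _ => 0)]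
    · simp
    · intro t ht
      have ht0 : 0 < t := h1n.trans (h1m.trans_lt ht.1)
      simp only
      rw [mainKernel, if_neg (by rw [abs_of_pos ht0]; exact fun h => absurd h.2 (not_le.2 ht.1)),
        abs_zero]
  rw [← intervalIntegral.integral_add_adjacent_intervals (hint 0 (1 / n)) (hint _ _),
    ← intervalIntegral.integral_add_adjacent_intervals (hint (1 / n) (1 / m)) (hint _ _), z1, z2,
    zero_add, add_zero]
  have hsub := intervalIntegral.mul_integral_comp_mul_left (a := 1 / (n : ℝ)) (b := 1 / m) (c := (n : ℝ))
    (f := fun u => |Real.sin (u + γ)| / u)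
  rw [show (n : ℝ) * (1 / n) = 1 by field_simp, mul_one_div] at hsub
  rw [← hsub, ← intervalIntegral.integral_const_mul]
  refine intervalIntegral.integral_congr fun t ht => ?_
  rw [Set.uIcc_of_le h1m] at ht
  have ht0 : 0 < t := h1n.trans_le ht.1
  rw [mainKernel, if_pos (by rw [abs_of_pos ht0]; exact ht), abs_div, abs_of_pos ht0]
  field_simp

lemma abs_integral_abs_mainKernel_sub_le {n : ℕ} (hn : 1 ≤ n) {m : ℝ} (hm1 : 1 ≤ m)
    (hmn : m ≤ n) (γ : ℝ) :
    |(∫ t in (-π)..π, |mainKernel n m γ t|) - 4 / π * Real.log (n / m)| ≤ 2 * π := by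
  rw [integral_eq_integral_pos_add fun a b => (intervalIntegrable_mainKernel hn m γ a b).abs]
  simp_rw [mainKernel_neg]
  rw [integral_abs_mainKernel_pos hn hm1 hmn, integral_abs_mainKernel_pos hn hm1 hmn]
  have hX : 1 ≤ n / m := by rw [one_le_div (by linarith)]; exact hmn
  have h1 := abs_le.1 (abs_integral_abs_sin_div_sub_le γ hX)
  have h2 := abs_le.1 (abs_integral_abs_sin_div_sub_le (-γ) hX)
  have e : 4 / π * Real.log (n / m) = 2 * (2 / π * Real.log (n / m)) := by ring
  rw [abs_le]
  constructor <;> linarith [h1.1, h1.2, h2.1, h2.2]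

lemma mainKernel_eq_zero {n : ℕ} {m γ t : ℝ} (hm1 : 1 ≤ m) (ht : 1 < |t|) :
    mainKernel n m γ t = 0 := by
  rw [mainKernel, if_neg]
  rintro ⟨-, h⟩
  have : 1 / m ≤ 1 := by rw [div_le_one (by linarith)]; exact hm1
  linarith

lemma exists_periodic_extension {g : ℝ → ℝ} (hg : Measurable g) :
    ∃ φ : ℝ → ℝ, Measurable φ ∧ Periodic2pi φ ∧ (∀ t, ∃ s, φ t = g s) ∧
      ∀ t ∈ Set.Ioo (-π) π, φ t = g t := by
  have hπ := Real.pi_pos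
  refine ⟨fun t => g (2 * π * Int.fract (t / (2 * π) + 1 / 2) - π), ?_, ?_, fun t => ⟨_, rfl⟩, ?_⟩
  · exact hg.comp ((((measurable_id.div_const _).add_const _).fract.const_mul _).sub_const _)
  · intro t
    simp only
    rw [show (t + 2 * π) / (2 * π) + 1 / 2 = t / (2 * π) + 1 / 2 + 1 by field_simp; ring,
      Int.fract_add_one]
  · intro t ht
    have h1 : -(1 / 2) < t / (2 * π) := by
      rw [lt_div_iff₀ (by positivity)]
      linarith [ht.1]
    have h2 : t / (2 * π) < 1 / 2 := by
      rw [div_lt_iff₀ (by positivity)]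
      linarith [ht.2]
    simp only
    rw [Int.fract_eq_self.2 ⟨by linarith, by linarith⟩]
    congr 1
    field_simp
    ring

/-- An extremal function of mean zero for the main part of the kernel. -/
lemma exists_extremal (n : ℕ) {m : ℝ} (hm1 : 1 ≤ m) (γ : ℝ) :
    ∃ φ : ℝ → ℝ, Measurable φ ∧ Periodic2pi φ ∧ (∀ t, |φ t| ≤ 1) ∧
      ∫ t in (-π)..π, φ t = 0 ∧
      ∫ t in (-π)..π, φ t * mainKernel n m γ t = ∫ t in (-π)..π, |mainKernel n m γ t| := by
  have hπ := Real.pi_gt_three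
  set s : ℝ → ℝ := fun t => if 0 ≤ mainKernel n m γ t then 1 else -1 with hs
  have hsm : Measurable s := Measurable.ite
    (measurableSet_le measurable_const (measurable_mainKernel n m γ)) measurable_const
    measurable_const
  have hs1 : ∀ t, |s t| = 1 := fun t => by
    simp only [hs]
    split_ifs <;> simp
  set c : ℝ := -(∫ t in (-1 : ℝ)..1, s t) / (2 * (π - 1)) with hc
  have hI : |∫ t in (-1 : ℝ)..1, s t| ≤ 2 := by
    have := intervalIntegral.norm_integral_le_of_norm_le_const (a := -1) (b := 1) (C := 1)
      (f := s) (fun t _ => (hs1 t).le)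
    rw [Real.norm_eq_abs] at this
    norm_num at this
    exact this
  have hc1 : |c| ≤ 1 := by
    rw [hc, abs_div, abs_neg, abs_of_pos (by linarith : 0 < 2 * (π - 1)),
      div_le_one (by linarith)]
    linarith
  set g : ℝ → ℝ := fun t => if |t| ≤ 1 then s t else c with hgd
  have hg : Measurable g := Measurable.ite (measurableSet_le measurable_norm measurable_const)
    hsm measurable_const
  have hg1 : ∀ t, |g t| ≤ 1 := fun t => by
    simp only [hgd]
    split_ifs
    exacts [(hs1 t).le, hc1]
  have hgi : ∀ a b, IntervalIntegrable g volume a b :=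
    intervalIntegrable_of_bounded hg (Eventually.of_forall hg1)
  obtain ⟨φ, hφm, hφp, hφg, hφ⟩ := exists_periodic_extension hg
  refine ⟨φ, hφm, hφp, fun t => ?_, ?_, ?_⟩
  · obtain ⟨u, hu⟩ := hφg t
    rw [hu]
    exact hg1 u
  · rw [intervalIntegral.integral_congr_Ioo_of_le (by linarith) hφ,
      ← intervalIntegral.integral_add_adjacent_intervals (hgi (-π) (-1)) (hgi _ _),
      ← intervalIntegral.integral_add_adjacent_intervals (hgi (-1) 1) (hgi _ _),
      intervalIntegral.integral_congr_Ioo_of_le (by linarith) (f := g) (g := fun _ => c),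
      intervalIntegral.integral_congr_Ioo_of_le (a := 1) (b := π) (by linarith) (f := g)
        (g := fun _ => c),
      intervalIntegral.integral_congr (a := -1) (b := 1) (f := g) (g := s)]
    · simp only [intervalIntegral.integral_const, smul_eq_mul, hc]
      have : π - 1 ≠ 0 := by linarith
      field_simp
      ring
    · intro t ht
      rw [Set.uIcc_of_le (by norm_num)] at ht
      simp only [hgd]
      rw [if_pos (abs_le.2 ht)]
    · intro t ht
      simp only [hgd]
      rw [if_neg (not_le.2 (ht.1.trans_le (le_abs_self t)))]
    · intro t ht
      simp only [hgd]
      rw [if_neg (not_le.2 (by linarith [neg_abs_le t, ht.2]))]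
  · refine intervalIntegral.integral_congr_Ioo_of_le (by linarith) fun t ht => ?_
    rw [hφ t ht]
    simp only [hgd, hs]
    by_cases h1 : |t| ≤ 1
    · rw [if_pos h1]
      split_ifs with h
      · rw [one_mul, abs_of_nonneg h]
      · rw [abs_of_neg (not_le.1 h), neg_one_mul]
    · rw [mainKernel_eq_zero hm1 (not_le.1 h1), mul_zero, abs_zero]

/-- The term of order `k` of the Fourier series of `φ`, shifted in phase by `γ`. -/
def phaseTerm (φ : ℝ → ℝ) (γ : ℝ) (k : ℕ) (x : ℝ) : ℝ :=
  fourierA φ k * Real.cos (k * x - γ) + fourierB φ k * Real.sin (k * x - γ)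

/-- The cosine coefficient of `phaseTerm`. -/
def phaseA (φ : ℝ → ℝ) (γ : ℝ) (k : ℕ) : ℝ :=
  fourierA φ k * Real.cos γ - fourierB φ k * Real.sin γ

/-- The sine coefficient of `phaseTerm`. -/
def phaseB (φ : ℝ → ℝ) (γ : ℝ) (k : ℕ) : ℝ :=
  fourierA φ k * Real.sin γ + fourierB φ k * Real.cos γ

lemma phaseTerm_eq (φ : ℝ → ℝ) (γ : ℝ) (k : ℕ) (x : ℝ) :
    phaseTerm φ γ k x = phaseA φ γ k * Real.cos (k * x) + phaseB φ γ k * Real.sin (k * x) := by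
  rw [phaseTerm, Real.cos_sub, Real.sin_sub, phaseA, phaseB]
  ring

lemma fourierB_zero (f : ℝ → ℝ) : fourierB f 0 = 0 := by
  simp [fourierB]

lemma phaseTerm_zero {φ : ℝ → ℝ} (h0 : fourierA φ 0 = 0) (γ x : ℝ) : phaseTerm φ γ 0 x = 0 := by
  rw [phaseTerm, h0, fourierB_zero]
  ring

lemma continuous_phaseTerm (φ : ℝ → ℝ) (γ : ℝ) (k : ℕ) : Continuous (phaseTerm φ γ k) := by
  unfold phaseTerm
  fun_prop

lemma periodic_cos_nat (k : ℕ) (δ : ℝ) : Periodic2pi fun x => Real.cos (k * x + δ) := fun x => by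
  simp only
  rw [show (k : ℝ) * (x + 2 * π) + δ = k * x + δ + k * (2 * π) by ring,
    Real.cos_add_nat_mul_two_pi]

lemma periodic_phaseTerm (φ : ℝ → ℝ) (γ : ℝ) (k : ℕ) : Periodic2pi (phaseTerm φ γ k) := fun x => by
  rw [phaseTerm, phaseTerm, show (k : ℝ) * (x + 2 * π) - γ = k * x - γ + k * (2 * π) by ring,
    Real.cos_add_nat_mul_two_pi, Real.sin_add_nat_mul_two_pi]

lemma SInf.intervalIntegrable {φ : ℝ → ℝ} (h : SInf φ) (a b : ℝ) :
    IntervalIntegrable φ volume a b := intervalIntegrable_of_bounded h.1 h.2.2 a b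

lemma SInf.shift {φ : ℝ → ℝ} (h : SInf φ) (x : ℝ) : SInf fun u => φ (x + u) :=
  ⟨h.1.comp (measurable_const_add x), fun u => by
    simp only
    rw [← add_assoc, h.2.1],
    (measurePreserving_add_left volume x).quasiMeasurePreserving.ae h.2.2⟩

lemma phaseTerm_eq_integral {φ : ℝ → ℝ} (h : SInf φ) (γ : ℝ) (k : ℕ) (x : ℝ) :
    phaseTerm φ γ k x = (1 / π) * ∫ u in (-π)..π, φ (x + u) * Real.cos (k * u + γ) := by
  have hper : Function.Periodic (fun t => φ t * Real.cos (k * t + (γ - k * x))) (2 * π) := fun t => by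
    simp only
    rw [h.2.1 t]
    exact congrArg _ (periodic_cos_nat k (γ - k * x) t)
  have h1 : ∫ u in (-π)..π, φ (x + u) * Real.cos (k * u + γ) =
      ∫ t in (-π)..π, φ t * Real.cos (k * t + (γ - k * x)) := by
    have e1 := intervalIntegral.integral_comp_add_left (a := -π) (b := π)
      (fun t => φ t * Real.cos (k * t + (γ - k * x))) x
    have e2 := hper.intervalIntegral_add_eq (x + -π) (-π)
    rw [show x + -π + 2 * π = x + π by ring, show -π + 2 * π = π by ring] at e2
    rw [← e2, ← e1]
    refine intervalIntegral.integral_congr fun u _ => ?_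
    ring_nf
  rw [h1, phaseTerm, fourierA, fourierB, mul_assoc, mul_assoc, ← mul_add,
    ← intervalIntegral.integral_mul_const, ← intervalIntegral.integral_mul_const,
    ← intervalIntegral.integral_add]
  · congr 1
    refine intervalIntegral.integral_congr fun t _ => ?_
    rw [show (k : ℝ) * t + (γ - k * x) = k * t - (k * x - γ) by ring,
      Real.cos_sub (k * t)]
    ring
  · exact ((h.intervalIntegrable _ _).mul_continuousOn (by fun_prop)).mul_const _
  · exact ((h.intervalIntegrable _ _).mul_continuousOn (by fun_prop)).mul_const _

/-- The mean of `φ` with the tent multipliers. -/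
def tentMean (φ : ℝ → ℝ) (γ : ℝ) (n l : ℕ) (x : ℝ) : ℝ :=
  ∑ k ∈ Finset.range (n + l), tentMul n l k * phaseTerm φ γ k x

lemma tentMean_eq_integral {φ : ℝ → ℝ} (h : SInf φ) (γ : ℝ) (n l : ℕ) (x : ℝ) :
    tentMean φ γ n l x = (1 / π) * ∫ u in (-π)..π, φ (x + u) * tentKernel n l γ u := by
  unfold tentMean tentKernel
  simp_rw [Finset.mul_sum]
  rw [intervalIntegral.integral_finsetSum, Finset.mul_sum]
  · refine Finset.sum_congr rfl fun k _ => ?_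
    rw [phaseTerm_eq_integral h, mul_left_comm, ← intervalIntegral.integral_const_mul]
    congr 1
    refine intervalIntegral.integral_congr fun u _ => ?_
    ring
  · exact fun k _ => ((h.shift x).intervalIntegrable _ _).mul_continuousOn (by fun_prop)

lemma abs_tentMean_le {φ : ℝ → ℝ} (h : SInf φ) (γ : ℝ) (n l : ℕ) (x : ℝ) :
    |tentMean φ γ n l x| ≤ (1 / π) * ∫ u in (-π)..π, |tentKernel n l γ u| := by
  rw [tentMean_eq_integral h, abs_mul, abs_of_pos (by positivity : 0 < 1 / π)]
  gcongr
  rw [← Real.norm_eq_abs]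
  refine intervalIntegral.norm_integral_le_of_norm_le (by linarith [Real.pi_pos]) ?_
    ((continuous_tentKernel n l γ).abs.intervalIntegrable (μ := volume) _ _)
  filter_upwards [(h.shift x).2.2] with u hu _
  rw [norm_mul]
  exact mul_le_of_le_one_left (norm_nonneg _) hu

lemma continuous_tentMean (φ : ℝ → ℝ) (γ : ℝ) (n l : ℕ) : Continuous (tentMean φ γ n l) :=
  continuous_finsetSum _ fun k _ => (continuous_phaseTerm φ γ k).const_mul _

lemma periodic_tentMean (φ : ℝ → ℝ) (γ : ℝ) (n l : ℕ) : Periodic2pi (tentMean φ γ n l) := fun x => by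
  unfold tentMean
  simp_rw [periodic_phaseTerm φ γ _ x]

lemma integral_cos_int (c : ℤ) : ∫ t in (-π)..π, Real.cos (c * t) = if c = 0 then 2 * π else 0 := by
  split_ifs with h
  · simp [h]
    ring
  · have hc : (c : ℝ) ≠ 0 := by exact_mod_cast h
    rw [intervalIntegral.integral_comp_mul_left (fun t => Real.cos t) hc, integral_cos]
    simp [Real.sin_int_mul_pi]

lemma integral_sin_odd (c : ℝ) : ∫ t in (-π)..π, Real.sin (c * t) = 0 := by
  have h := intervalIntegral.integral_comp_neg (a := -π) (b := π) fun t => Real.sin (c * t)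
  simp only [mul_neg, Real.sin_neg, intervalIntegral.integral_neg, neg_neg] at h
  linarith

lemma integral_cos_mul_cos (j k : ℕ) : ∫ t in (-π)..π, Real.cos (k * t) * Real.cos (j * t) =
    if j = k then (if k = 0 then 2 * π else π) else 0 := by
  have e : ∀ t : ℝ, Real.cos (k * t) * Real.cos (j * t) =
      1 / 2 * Real.cos (((k - j : ℤ) : ℝ) * t) + 1 / 2 * Real.cos (((k + j : ℤ) : ℝ) * t) := fun t => by
    push_cast
    rw [sub_mul, add_mul, Real.cos_sub, Real.cos_add]
    ring
  simp_rw [e]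
  rw [intervalIntegral.integral_add (Continuous.intervalIntegrable (by fun_prop) _ _)
    (Continuous.intervalIntegrable (by fun_prop) _ _), intervalIntegral.integral_const_mul,
    intervalIntegral.integral_const_mul, integral_cos_int, integral_cos_int]
  split_ifs <;> first | omega | ring

lemma integral_sin_mul_sin (j k : ℕ) : ∫ t in (-π)..π, Real.sin (k * t) * Real.sin (j * t) =
    if j = k then (if k = 0 then 0 else π) else 0 := by
  have e : ∀ t : ℝ, Real.sin (k * t) * Real.sin (j * t) =
      1 / 2 * Real.cos (((k - j : ℤ) : ℝ) * t) - 1 / 2 * Real.cos (((k + j : ℤ) : ℝ) * t) := fun t => by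
    push_cast
    rw [sub_mul, add_mul, Real.cos_sub, Real.cos_add]
    ring
  simp_rw [e]
  rw [intervalIntegral.integral_sub (Continuous.intervalIntegrable (by fun_prop) _ _)
    (Continuous.intervalIntegrable (by fun_prop) _ _), intervalIntegral.integral_const_mul,
    intervalIntegral.integral_const_mul, integral_cos_int, integral_cos_int]
  split_ifs <;> first | omega | ring

lemma integral_sin_mul_cos (j k : ℕ) :
    ∫ t in (-π)..π, Real.sin (k * t) * Real.cos (j * t) = 0 := by
  have e : ∀ t : ℝ, Real.sin (k * t) * Real.cos (j * t) =
      1 / 2 * Real.sin (((k : ℝ) - j) * t) + 1 / 2 * Real.sin (((k : ℝ) + j) * t) := fun t => by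
    rw [sub_mul, add_mul, Real.sin_sub, Real.sin_add]
    ring
  simp_rw [e]
  rw [intervalIntegral.integral_add (Continuous.intervalIntegrable (by fun_prop) _ _)
    (Continuous.intervalIntegrable (by fun_prop) _ _), intervalIntegral.integral_const_mul,
    intervalIntegral.integral_const_mul, integral_sin_odd, integral_sin_odd]
  ring

lemma fourierA_phaseTerm {φ : ℝ → ℝ} (h0 : fourierA φ 0 = 0) (γ : ℝ) (k j : ℕ) :
    fourierA (phaseTerm φ γ k) j = if j = k then phaseA φ γ j else 0 := by
  have hp : k = 0 → phaseA φ γ k = 0 := fun hk => by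
    rw [hk, phaseA, h0, fourierB_zero]
    ring
  unfold fourierA
  simp_rw [phaseTerm_eq, add_mul, mul_assoc]
  rw [intervalIntegral.integral_add (Continuous.intervalIntegrable (by fun_prop) _ _)
    (Continuous.intervalIntegrable (by fun_prop) _ _), intervalIntegral.integral_const_mul,
    intervalIntegral.integral_const_mul, integral_cos_mul_cos, integral_sin_mul_cos]
  have := Real.pi_pos.ne'
  split_ifs with h1 h2
  · rw [h1, hp h2]
    ring
  · rw [h1]
    field_simp
    ring
  · ring

lemma fourierB_phaseTerm {φ : ℝ → ℝ} (h0 : fourierA φ 0 = 0) (γ : ℝ) (k j : ℕ) :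
    fourierB (phaseTerm φ γ k) j = if j = k then phaseB φ γ j else 0 := by
  have hp : k = 0 → phaseB φ γ k = 0 := fun hk => by
    rw [hk, phaseB, h0, fourierB_zero]
    ring
  unfold fourierB
  simp_rw [phaseTerm_eq, add_mul, mul_assoc, mul_comm (Real.cos _)]
  rw [intervalIntegral.integral_add (Continuous.intervalIntegrable (by fun_prop) _ _)
    (Continuous.intervalIntegrable (by fun_prop) _ _), intervalIntegral.integral_const_mul,
    intervalIntegral.integral_const_mul, integral_sin_mul_sin, integral_sin_mul_cos]
  have := Real.pi_pos.ne'
  split_ifs with h1 h2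
  · rw [h1, hp h2]
    ring
  · rw [h1]
    field_simp
    ring
  · ring

lemma eq_zero_of_fourier_eq_zero {f : ℝ → ℝ} (hf : Continuous f) (hp : Periodic2pi f)
    (hA : ∀ k, fourierA f k = 0) (hB : ∀ k, fourierB f k = 0) (x : ℝ) : f x = 0 := by
  have : Fact (0 < 2 * π) := ⟨Real.two_pi_pos⟩
  have hpi : (1 / π) ≠ 0 := by positivity
  have hA' : ∀ k : ℕ, ∫ t in (-π)..π, f t * Real.cos (k * t) = 0 := fun k =>
    (mul_eq_zero.1 (hA k)).resolve_left hpi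
  have hB' : ∀ k : ℕ, ∫ t in (-π)..π, f t * Real.sin (k * t) = 0 := fun k =>
    (mul_eq_zero.1 (hB k)).resolve_left hpi
  have hAz : ∀ k : ℤ, ∫ t in (-π)..π, f t * Real.cos (k * t) = 0 := fun k => by
    obtain ⟨j, rfl | rfl⟩ := k.eq_nat_or_neg
    · simpa using hA' j
    · simpa using hA' j
  have hBz : ∀ k : ℤ, ∫ t in (-π)..π, f t * Real.sin (k * t) = 0 := fun k => by
    obtain ⟨j, rfl | rfl⟩ := k.eq_nat_or_neg
    · simpa using hB' j
    · simpa using hB' j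
  have hper : Function.Periodic (fun t => (f t : ℂ)) (2 * π) := fun t => by
    simp only
    rw [hp t]
  set g : C(AddCircle (2 * π), ℂ) := ⟨hper.lift, continuous_coinduced_dom.2
    (Complex.continuous_ofReal.comp hf)⟩ with hg
  have hgc : ∀ t : ℝ, g (t : AddCircle (2 * π)) = (f t : ℂ) := fun t => rfl
  have hcoef : ∀ k, fourierCoeff g k = 0 := fun k => by
    rw [fourierCoeff_eq_intervalIntegral _ _ (-π), show -π + 2 * π = π by ring]
    have e : ∀ t : ℝ, fourier (-k) (t : AddCircle (2 * π)) • g (t : AddCircle (2 * π)) =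
        ((f t * Real.cos (k * t) : ℝ) : ℂ) - Complex.I * ((f t * Real.sin (k * t) : ℝ) : ℂ) :=
      fun t => by
        rw [hgc, fourier_coe_apply, show (2 * π * Complex.I * (-k : ℤ) * t / (2 * π : ℝ) : ℂ) =
          ((-(k * t) : ℝ) : ℂ) * Complex.I by
            push_cast
            have : (π : ℂ) ≠ 0 := by exact_mod_cast Real.pi_ne_zero
            field_simp, Complex.exp_mul_I, ← Complex.ofReal_cos, ← Complex.ofReal_sin,
          Real.cos_neg, Real.sin_neg, smul_eq_mul]
        push_cast
        ring
    simp_rw [e]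
    rw [intervalIntegral.integral_sub (Continuous.intervalIntegrable (by fun_prop) _ _)
      (Continuous.intervalIntegrable (by fun_prop) _ _), intervalIntegral.integral_const_mul,
      intervalIntegral.integral_ofReal, intervalIntegral.integral_ofReal, hAz, hBz]
    simp
  have hsum : Summable (fourierCoeff g) := by
    rw [show fourierCoeff g = fun _ => 0 from funext hcoef]
    exact summable_zero
  have h := has_pointwise_sum_fourier_series_of_summable hsum (x : AddCircle (2 * π))
  simp_rw [hcoef, zero_smul] at h
  have := h.unique hasSum_zero
  rw [hgc] at this
  exact_mod_cast this

lemma hasSum_integral_mul {F : ℕ → ℝ → ℝ} {b : ℕ → ℝ} (hF : ∀ i, Continuous (F i))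
    (hb : Summable b) (hFb : ∀ i x, |F i x| ≤ b i) {g : ℝ → ℝ} (hg : Continuous g)
    (hg1 : ∀ t, |g t| ≤ 1) :
    HasSum (fun i => ∫ t in (-π)..π, F i t * g t) (∫ t in (-π)..π, (∑' i, F i t) * g t) := by
  refine intervalIntegral.hasSum_integral_of_dominated_convergence
    (F := fun i t => F i t * g t) (f := fun t => (∑' i, F i t) * g t) (fun i _ => b i)
    (fun i => ((hF i).mul hg).aestronglyMeasurable) (fun i => ?_)
    (Eventually.of_forall fun _ _ => hb) intervalIntegrable_const
    (Eventually.of_forall fun t _ => ?_)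
  · refine Eventually.of_forall fun t _ => ?_
    rw [norm_mul]
    exact (mul_le_of_le_one_right (norm_nonneg _) (hg1 t)).trans (hFb i t)
  · have hs : Summable fun i => F i t := Summable.of_norm_bounded hb fun i => hFb i t
    exact hs.hasSum.mul_right (g t)

lemma hasSum_fourierA {F : ℕ → ℝ → ℝ} {b : ℕ → ℝ} (hF : ∀ i, Continuous (F i))
    (hb : Summable b) (hFb : ∀ i x, |F i x| ≤ b i) (k : ℕ) :
    HasSum (fun i => fourierA (F i) k) (fourierA (fun x => ∑' i, F i x) k) :=
  (hasSum_integral_mul hF hb hFb (by fun_prop) fun _ => Real.abs_cos_le_one _).mul_left _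

lemma hasSum_fourierB {F : ℕ → ℝ → ℝ} {b : ℕ → ℝ} (hF : ∀ i, Continuous (F i))
    (hb : Summable b) (hFb : ∀ i x, |F i x| ≤ b i) (k : ℕ) :
    HasSum (fun i => fourierB (F i) k) (fourierB (fun x => ∑' i, F i x) k) :=
  (hasSum_integral_mul hF hb hFb (by fun_prop) fun _ => Real.abs_sin_le_one _).mul_left _

lemma fourierA_add {f g : ℝ → ℝ} (hf : Continuous f) (hg : Continuous g) (k : ℕ) :
    fourierA (fun x => f x + g x) k = fourierA f k + fourierA g k := by
  simp only [fourierA, add_mul]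
  rw [intervalIntegral.integral_add (Continuous.intervalIntegrable (by fun_prop) _ _)
    (Continuous.intervalIntegrable (by fun_prop) _ _), mul_add]

lemma fourierB_add {f g : ℝ → ℝ} (hf : Continuous f) (hg : Continuous g) (k : ℕ) :
    fourierB (fun x => f x + g x) k = fourierB f k + fourierB g k := by
  simp only [fourierB, add_mul]
  rw [intervalIntegral.integral_add (Continuous.intervalIntegrable (by fun_prop) _ _)
    (Continuous.intervalIntegrable (by fun_prop) _ _), mul_add]

lemma fourierA_const_mul (c : ℝ) (f : ℝ → ℝ) (k : ℕ) :
    fourierA (fun x => c * f x) k = c * fourierA f k := by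
  simp only [fourierA, mul_assoc, intervalIntegral.integral_const_mul]
  ring

lemma fourierB_const_mul (c : ℝ) (f : ℝ → ℝ) (k : ℕ) :
    fourierB (fun x => c * f x) k = c * fourierB f k := by
  simp only [fourierB, mul_assoc, intervalIntegral.integral_const_mul]
  ring

lemma fourierA_const (c : ℝ) (k : ℕ) :
    fourierA (fun _ => c) k = if k = 0 then 2 * c else 0 := by
  have h := integral_cos_int k
  simp only [Int.cast_natCast, Int.natCast_eq_zero] at h
  rw [fourierA, intervalIntegral.integral_const_mul, h]
  have := Real.pi_pos.ne'
  split_ifs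
  · field_simp
  · ring

lemma fourierB_const (c : ℝ) (k : ℕ) : fourierB (fun _ => c) k = 0 := by
  rw [fourierB, intervalIntegral.integral_const_mul, integral_sin_odd]
  ring

lemma fourierA_sum {s : Finset ℕ} (c : ℕ → ℝ) {F : ℕ → ℝ → ℝ} (hF : ∀ k, Continuous (F k))
    (j : ℕ) : fourierA (fun x => ∑ k ∈ s, c k * F k x) j = ∑ k ∈ s, c k * fourierA (F k) j := by
  simp only [fourierA, Finset.sum_mul]
  rw [intervalIntegral.integral_finsetSum fun k _ =>
    Continuous.intervalIntegrable (by have := hF k; fun_prop) _ _, Finset.mul_sum]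
  refine Finset.sum_congr rfl fun k _ => ?_
  simp only [mul_assoc, intervalIntegral.integral_const_mul]
  ring

lemma fourierB_sum {s : Finset ℕ} (c : ℕ → ℝ) {F : ℕ → ℝ → ℝ} (hF : ∀ k, Continuous (F k))
    (j : ℕ) : fourierB (fun x => ∑ k ∈ s, c k * F k x) j = ∑ k ∈ s, c k * fourierB (F k) j := by
  simp only [fourierB, Finset.sum_mul]
  rw [intervalIntegral.integral_finsetSum fun k _ =>
    Continuous.intervalIntegrable (by have := hF k; fun_prop) _ _, Finset.mul_sum]
  refine Finset.sum_congr rfl fun k _ => ?_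
  simp only [mul_assoc, intervalIntegral.integral_const_mul]
  ring

lemma tentMul_eq_zero {n l k : ℕ} (hl : 1 ≤ l) (hk : n + l ≤ k) : tentMul n l k = 0 := by
  have hl' : (0 : ℝ) < l := by exact_mod_cast hl
  have hk' : (n : ℝ) + l ≤ k := by exact_mod_cast hk
  rw [tentMul, if_neg (by omega), max_eq_left]
  rw [sub_nonpos, le_div_iff₀ hl']
  linarith

lemma fourierA_tentMean {φ : ℝ → ℝ} (h0 : fourierA φ 0 = 0) (γ : ℝ) (n : ℕ) {l : ℕ}
    (hl : 1 ≤ l) (j : ℕ) :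
    fourierA (tentMean φ γ n l) j = tentMul n l j * phaseA φ γ j := by
  unfold tentMean
  rw [fourierA_sum _ (continuous_phaseTerm φ γ)]
  simp_rw [fourierA_phaseTerm h0, mul_ite, mul_zero]
  rw [Finset.sum_ite_eq]
  split_ifs with h
  · rfl
  · rw [tentMul_eq_zero hl (by simpa using h), zero_mul]

lemma fourierB_tentMean {φ : ℝ → ℝ} (h0 : fourierA φ 0 = 0) (γ : ℝ) (n : ℕ) {l : ℕ}
    (hl : 1 ≤ l) (j : ℕ) :
    fourierB (tentMean φ γ n l) j = tentMul n l j * phaseB φ γ j := by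
  unfold tentMean
  rw [fourierB_sum _ (continuous_phaseTerm φ γ)]
  simp_rw [fourierB_phaseTerm h0, mul_ite, mul_zero]
  rw [Finset.sum_ite_eq]
  split_ifs with h
  · rfl
  · rw [tentMul_eq_zero hl (by simpa using h), zero_mul]

/-- The multipliers `k ψ(n) / n` (`k < n`) and `ψ(k)` (`k ≥ n`) of the deviation of the Zygmund
sums are a summable combination of tents with coefficients `c`. -/
structure TentExpansion (ψ : ℕ → ℝ) (n : ℕ) (γ : ℝ) (c : ℕ → ℝ) : Prop where
  nonneg : ∀ i, 0 ≤ c i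
  summable : Summable fun i => c i * ∫ u in (-π)..π, |tentKernel n (i + 1) γ u|
  hasSum : ∀ k, HasSum (fun i => c i * tentMul n (i + 1) k)
    (if k < n then (k : ℝ) * ψ n / n else ψ k)

/-- The combination of tent means with coefficients `c`. -/
def tentSum (φ : ℝ → ℝ) (γ : ℝ) (n : ℕ) (c : ℕ → ℝ) (x : ℝ) : ℝ :=
  ∑' i, c i * tentMean φ γ n (i + 1) x

lemma periodic_tentSum (φ : ℝ → ℝ) (γ : ℝ) (n : ℕ) (c : ℕ → ℝ) :
    Periodic2pi (tentSum φ γ n c) := fun x => by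
  unfold tentSum
  simp_rw [periodic_tentMean φ γ n _ x]

namespace TentExpansion

variable {ψ : ℕ → ℝ} {n : ℕ} {γ : ℝ} {c : ℕ → ℝ}

lemma abs_term_le (h : TentExpansion ψ n γ c) {φ : ℝ → ℝ} (hφ : SInf φ) (i : ℕ) (x : ℝ) :
    |c i * tentMean φ γ n (i + 1) x| ≤
      (1 / π) * (c i * ∫ u in (-π)..π, |tentKernel n (i + 1) γ u|) := by
  rw [abs_mul, abs_of_nonneg (h.nonneg i), mul_left_comm]
  exact mul_le_mul_of_nonneg_left (abs_tentMean_le hφ γ n (i + 1) x) (h.nonneg i)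

lemma continuous_tentSum (h : TentExpansion ψ n γ c) {φ : ℝ → ℝ} (hφ : SInf φ) :
    Continuous (tentSum φ γ n c) :=
  continuous_tsum (fun i => (continuous_tentMean φ γ n (i + 1)).const_mul _)
    (h.summable.mul_left (1 / π)) fun i x => h.abs_term_le hφ i x

lemma abs_tentSum_le (h : TentExpansion ψ n γ c) {φ : ℝ → ℝ} (hφ : SInf φ) (x : ℝ) :
    |tentSum φ γ n c x| ≤ (1 / π) * ∑' i, c i * ∫ u in (-π)..π, |tentKernel n (i + 1) γ u| := by
  rw [← Real.norm_eq_abs, tentSum]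
  exact tsum_of_norm_bounded (h.summable.hasSum.mul_left (1 / π)) fun i => h.abs_term_le hφ i x

lemma fourierA_tentSum (h : TentExpansion ψ n γ c) {φ : ℝ → ℝ} (hφ : SInf φ)
    (h0 : fourierA φ 0 = 0) (k : ℕ) :
    fourierA (tentSum φ γ n c) k =
      (if k < n then (k : ℝ) * ψ n / n else ψ k) * phaseA φ γ k := by
  have h1 := hasSum_fourierA (F := fun i x => c i * tentMean φ γ n (i + 1) x)
    (fun i => (continuous_tentMean φ γ n (i + 1)).const_mul _)
    (h.summable.mul_left (1 / π)) (fun i x => h.abs_term_le hφ i x) k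
  refine h1.unique (((h.hasSum k).mul_right (phaseA φ γ k)).congr_fun fun i => ?_)
  rw [fourierA_const_mul, fourierA_tentMean h0 γ n (Nat.le_add_left 1 i), mul_assoc]

lemma fourierB_tentSum (h : TentExpansion ψ n γ c) {φ : ℝ → ℝ} (hφ : SInf φ)
    (h0 : fourierA φ 0 = 0) (k : ℕ) :
    fourierB (tentSum φ γ n c) k =
      (if k < n then (k : ℝ) * ψ n / n else ψ k) * phaseB φ γ k := by
  have h1 := hasSum_fourierB (F := fun i x => c i * tentMean φ γ n (i + 1) x)
    (fun i => (continuous_tentMean φ γ n (i + 1)).const_mul _)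
    (h.summable.mul_left (1 / π)) (fun i x => h.abs_term_le hφ i x) k
  refine h1.unique (((h.hasSum k).mul_right (phaseB φ γ k)).congr_fun fun i => ?_)
  rw [fourierB_const_mul, fourierB_tentMean h0 γ n (Nat.le_add_left 1 i), mul_assoc]

end TentExpansion

/-- A function with `(ψ,β)`-derivative `φ`, where `γ = βπ/2`. -/
def psiIntegral (ψ : ℕ → ℝ) (φ : ℝ → ℝ) (γ : ℝ) (n : ℕ) (c : ℕ → ℝ) (x : ℝ) : ℝ :=
  tentSum φ γ n c x + ∑ k ∈ Finset.range n, (ψ k - k * ψ n / n) * phaseTerm φ γ k x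

lemma periodic_psiIntegral (ψ : ℕ → ℝ) (φ : ℝ → ℝ) (γ : ℝ) (n : ℕ) (c : ℕ → ℝ) :
    Periodic2pi (psiIntegral ψ φ γ n c) := fun x => by
  unfold psiIntegral
  simp_rw [periodic_tentSum φ γ n c x, periodic_phaseTerm φ γ _ x]

lemma continuous_sum_phaseTerm (φ : ℝ → ℝ) (γ : ℝ) (n : ℕ) (d : ℕ → ℝ) :
    Continuous fun x => ∑ k ∈ Finset.range n, d k * phaseTerm φ γ k x :=
  continuous_finsetSum _ fun k _ => (continuous_phaseTerm φ γ k).const_mul _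

namespace TentExpansion

variable {ψ : ℕ → ℝ} {n : ℕ} {γ : ℝ} {c : ℕ → ℝ}

lemma continuous_psiIntegral (h : TentExpansion ψ n γ c) {φ : ℝ → ℝ} (hφ : SInf φ) :
    Continuous (psiIntegral ψ φ γ n c) :=
  (h.continuous_tentSum hφ).add (continuous_sum_phaseTerm φ γ n _)

lemma fourierA_psiIntegral (h : TentExpansion ψ n γ c) {φ : ℝ → ℝ} (hφ : SInf φ)
    (h0 : fourierA φ 0 = 0) (k : ℕ) :
    fourierA (psiIntegral ψ φ γ n c) k = ψ k * phaseA φ γ k := by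
  unfold psiIntegral
  rw [fourierA_add (h.continuous_tentSum hφ) (continuous_sum_phaseTerm φ γ n _),
    h.fourierA_tentSum hφ h0, fourierA_sum (fun k => ψ k - k * ψ n / n) (continuous_phaseTerm φ γ)]
  simp_rw [fourierA_phaseTerm h0, mul_ite, mul_zero]
  rw [Finset.sum_ite_eq]
  simp only [Finset.mem_range]
  split_ifs <;> ring

lemma fourierB_psiIntegral (h : TentExpansion ψ n γ c) {φ : ℝ → ℝ} (hφ : SInf φ)
    (h0 : fourierA φ 0 = 0) (k : ℕ) :
    fourierB (psiIntegral ψ φ γ n c) k = ψ k * phaseB φ γ k := by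
  unfold psiIntegral
  rw [fourierB_add (h.continuous_tentSum hφ) (continuous_sum_phaseTerm φ γ n _),
    h.fourierB_tentSum hφ h0, fourierB_sum (fun k => ψ k - k * ψ n / n) (continuous_phaseTerm φ γ)]
  simp_rw [fourierB_phaseTerm h0, mul_ite, mul_zero]
  rw [Finset.sum_ite_eq]
  simp only [Finset.mem_range]
  split_ifs <;> ring

lemma isPsiDeriv_psiIntegral {β : ℝ} (h : TentExpansion ψ n (β * π / 2) c)
    (hψ : ∀ k, 1 ≤ k → ψ k ≠ 0) {φ : ℝ → ℝ} (hφ : SInf φ) (h0 : fourierA φ 0 = 0) :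
    IsPsiDeriv ψ β (psiIntegral ψ φ (β * π / 2) n c) φ := by
  refine ⟨hφ, h0, fun k hk => ?_⟩
  have hk' := hψ k hk
  have hsq := Real.sin_sq_add_cos_sq (β * π / 2)
  rw [h.fourierA_psiIntegral hφ h0, h.fourierB_psiIntegral hφ h0, phaseA, phaseB]
  constructor
  · field_simp
    linear_combination (-fourierA φ k) * hsq
  · field_simp
    linear_combination (-fourierB φ k) * hsq

end TentExpansion

lemma IsPsiDeriv.fourierA_eq {ψ : ℕ → ℝ} {β : ℝ} {f φ : ℝ → ℝ} (h : IsPsiDeriv ψ β f φ) {k : ℕ}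
    (hk : 1 ≤ k) (hψ : ψ k ≠ 0) : fourierA f k = ψ k * phaseA φ (β * π / 2) k := by
  obtain ⟨h1, h2⟩ := h.2.2 k hk
  have hsq := Real.sin_sq_add_cos_sq (β * π / 2)
  rw [phaseA, h1, h2]
  field_simp
  linear_combination (-fourierA f k) * hsq

lemma IsPsiDeriv.fourierB_eq {ψ : ℕ → ℝ} {β : ℝ} {f φ : ℝ → ℝ} (h : IsPsiDeriv ψ β f φ) {k : ℕ}
    (hk : 1 ≤ k) (hψ : ψ k ≠ 0) : fourierB f k = ψ k * phaseB φ (β * π / 2) k := by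
  obtain ⟨h1, h2⟩ := h.2.2 k hk
  have hsq := Real.sin_sq_add_cos_sq (β * π / 2)
  rw [phaseB, h1, h2]
  field_simp
  linear_combination (-fourierB f k) * hsq

/-- The deviation of the Zygmund sum is the combination of tent means of the derivative. -/
lemma TentExpansion.sub_zygmundSum_eq {ψ : ℕ → ℝ} {n : ℕ} {β : ℝ} {c : ℕ → ℝ}
    (h : TentExpansion ψ n (β * π / 2) c) (hn : 1 ≤ n) (hψ : ∀ k, 1 ≤ k → ψ k ≠ 0)
    {f φ : ℝ → ℝ} (hf : Continuous f) (hfp : Periodic2pi f) (hd : IsPsiDeriv ψ β f φ) (x : ℝ) :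
    f x - ZygmundSum (fun k => (k : ℝ) / ψ k) n f x = tentSum φ (β * π / 2) n c x := by
  set γ := β * π / 2 with hγ
  obtain ⟨hφ, h0, -⟩ := id hd
  have hF := h.continuous_psiIntegral hφ
  have hA0 : phaseA φ γ 0 = 0 := by rw [phaseA, h0, fourierB_zero]; ring
  have hcF : Continuous fun x => (-1) * psiIntegral ψ φ γ n c x := hF.const_mul _
  have hc1 : Continuous fun x => f x + (-1) * psiIntegral ψ φ γ n c x := hf.add hcF
  have key := eq_zero_of_fourier_eq_zero
    (f := fun x => f x + (-1) * psiIntegral ψ φ γ n c x + -(fourierA f 0 / 2))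
    (hc1.add continuous_const)
    (fun x => by simp only [hfp x, periodic_psiIntegral ψ φ γ n c x])
    (fun k => by
      rw [fourierA_add hc1 continuous_const, fourierA_add hf hcF, fourierA_const_mul,
        fourierA_const, h.fourierA_psiIntegral hφ h0]
      split_ifs with hk
      · rw [hk, hA0]
        ring
      · rw [hd.fourierA_eq (Nat.one_le_iff_ne_zero.2 hk) (hψ k (Nat.one_le_iff_ne_zero.2 hk))]
        ring)
    (fun k => by
      rw [fourierB_add hc1 continuous_const, fourierB_add hf hcF, fourierB_const_mul,
        fourierB_const, h.fourierB_psiIntegral hφ h0]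
      rcases Nat.eq_zero_or_pos k with rfl | hk
      · rw [fourierB_zero, phaseB, h0, fourierB_zero]
        ring
      · rw [hd.fourierB_eq hk (hψ k hk)]
        ring) x
  have hfx : f x = psiIntegral ψ φ γ n c x + fourierA f 0 / 2 := by linarith
  have hn0 : (n : ℝ) ≠ 0 := by exact_mod_cast (by omega : n ≠ 0)
  have hZ : ZygmundSum (fun k => (k : ℝ) / ψ k) n f x =
      fourierA f 0 / 2 + ∑ k ∈ Finset.range n, (ψ k - k * ψ n / n) * phaseTerm φ γ k x := by
    obtain ⟨p, rfl⟩ : ∃ p, n = p + 1 := ⟨n - 1, by omega⟩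
    rw [ZygmundSum, Finset.sum_range_succ', Finset.sum_range_succ', phaseTerm_zero h0, mul_zero,
      add_zero, add_comm]
    congr 1
    · simp [harmonicTerm]
    · refine Finset.sum_congr rfl fun k _ => ?_
      have hk := hψ (k + 1) (by omega)
      have hN := hψ (p + 1) (by omega)
      rw [harmonicTerm, if_neg (by omega), hd.fourierA_eq (by omega) hk,
        hd.fourierB_eq (by omega) hk, phaseTerm_eq, ← hγ]
      field_simp
  rw [hZ, hfx, psiIntegral]
  ring

lemma MClass.tentExpansion {ψ : ℝ → ℝ} (hψ : MClass ψ) {n : ℕ} (hn : 1 ≤ n) {γ : ℝ}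
    (hs : Summable fun i : ℕ => ((i : ℝ) + 1) * secondDiff (fun j : ℕ => ψ ((n : ℝ) + j)) i *
      ∫ u in (-π)..π, |tentKernel n (i + 1) γ u|) :
    TentExpansion (fun k : ℕ => ψ k) n γ
      (fun i : ℕ => ((i : ℝ) + 1) * secondDiff (fun j : ℕ => ψ ((n : ℝ) + j)) i) where
  nonneg i := mul_nonneg (by positivity) (hψ.secondDiff_nonneg hn i)
  summable := hs
  hasSum k := by
    have ha := hψ.antitone_nat hn
    have hc := hψ.secondDiff_nonneg hn
    have h0 := hψ.tendsto_nat n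
    split_ifs with hk
    · simp only [tentMul, if_pos hk]
      have h := (hasSum_mul_secondDiff ha hc h0).mul_right ((k : ℝ) / n)
      simp only [Nat.cast_zero, add_zero] at h
      rwa [mul_comm (k : ℝ), mul_div_assoc]
    · obtain ⟨j, rfl⟩ := Nat.exists_eq_add_of_le (not_lt.1 hk)
      simp only [tentMul, if_neg hk]
      have h := hasSum_tent ha hc h0 j
      push_cast
      simpa only [add_sub_cancel_left] using h

lemma integral_abs_tentKernel_le {n l : ℕ} (hn : 1 ≤ n) (hl : 1 ≤ l) {m : ℝ}
    (hm1 : 1 ≤ m) (hmn : m ≤ n) (γ : ℝ) :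
    ∫ t in (-π)..π, |tentKernel n l γ t| ≤ (∫ t in (-π)..π, |mainKernel n m γ t|) +
      38 * (1 + Real.log (2 + l / m) + m / l) := by
  have hT := (continuous_tentKernel n l γ).intervalIntegrable (μ := volume) (-π) π
  have hM := intervalIntegrable_mainKernel hn m γ (-π) π
  calc _ ≤ ∫ t in (-π)..π, (|mainKernel n m γ t| + |tentKernel n l γ t - mainKernel n m γ t|) := by
        refine intervalIntegral.integral_mono_on (by linarith [Real.pi_pos]) hT.abs
          (hM.abs.add (hT.sub hM).abs) fun t _ => ?_
        have := abs_add_le (mainKernel n m γ t) (tentKernel n l γ t - mainKernel n m γ t)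
        rwa [add_sub_cancel] at this
    _ ≤ _ := by
        rw [intervalIntegral.integral_add hM.abs (hT.sub hM).abs]
        linarith [integral_abs_tentKernel_sub_le hn hl hm1 hmn γ]

lemma le_tentMean_zero {n l : ℕ} (hn : 1 ≤ n) (hl : 1 ≤ l) {m : ℝ} (hm1 : 1 ≤ m) (hmn : m ≤ n)
    {γ : ℝ} {φ : ℝ → ℝ} (hφ : SInf φ)
    (hφM : ∫ t in (-π)..π, φ t * mainKernel n m γ t = ∫ t in (-π)..π, |mainKernel n m γ t|) :
    (1 / π) * ((∫ t in (-π)..π, |mainKernel n m γ t|) -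
      38 * (1 + Real.log (2 + l / m) + m / l)) ≤ tentMean φ γ n l 0 := by
  have hT := (continuous_tentKernel n l γ).intervalIntegrable (μ := volume) (-π) π
  have hM := intervalIntegrable_mainKernel hn m γ (-π) π
  rw [tentMean_eq_integral hφ]
  simp_rw [zero_add]
  gcongr
  have hφT : IntervalIntegrable (fun t => φ t * tentKernel n l γ t) volume (-π) π :=
    (hφ.intervalIntegrable _ _).mul_continuousOn (continuous_tentKernel n l γ).continuousOn
  have hφM' : IntervalIntegrable (fun t => φ t * mainKernel n m γ t) volume (-π) π :=
    intervalIntegrable_of_bounded (hφ.1.mul (measurable_mainKernel n m γ)) (c := n)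
      (hφ.2.2.mono fun t ht => by
        rw [Pi.mul_apply, abs_mul]
        exact (mul_le_of_le_one_left (abs_nonneg _) ht).trans (abs_mainKernel_le hn m γ t)) _ _
  have hb : |∫ t in (-π)..π, (φ t * tentKernel n l γ t - φ t * mainKernel n m γ t)| ≤
      ∫ t in (-π)..π, |tentKernel n l γ t - mainKernel n m γ t| := by
    rw [← Real.norm_eq_abs]
    refine intervalIntegral.norm_integral_le_of_norm_le (by linarith [Real.pi_pos]) ?_
      (hT.sub hM).abs
    filter_upwards [hφ.2.2] with t ht _
    rw [← mul_sub, norm_mul]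
    exact mul_le_of_le_one_left (norm_nonneg _) ht
  rw [intervalIntegral.integral_sub hφT hφM', hφM] at hb
  linarith [(abs_le.1 hb).1, integral_abs_tentKernel_sub_le hn hl hm1 hmn γ]

lemma TentExpansion.classSup_le {ψ : ℕ → ℝ} {n : ℕ} {β : ℝ} {c : ℕ → ℝ}
    (h : TentExpansion ψ n (β * π / 2) c) (hn : 1 ≤ n) (hψ : ∀ k, 1 ≤ k → ψ k ≠ 0) {f : ℝ → ℝ}
    (hf : ClassC ψ β f) : ⨆ x : ℝ, |f x - ZygmundSum (fun k => (k : ℝ) / ψ k) n f x| ≤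
      (1 / π) * ∑' i, c i * ∫ u in (-π)..π, |tentKernel n (i + 1) (β * π / 2) u| := by
  obtain ⟨hfc, hfp, φ, hφ⟩ := hf
  refine ciSup_le fun x => ?_
  rw [h.sub_zygmundSum_eq hn hψ hfc hfp hφ]
  exact h.abs_tentSum_le hφ.1 x

lemma TentExpansion.le_classSup {ψ : ℕ → ℝ} {n : ℕ} {β : ℝ} {c : ℕ → ℝ}
    (h : TentExpansion ψ n (β * π / 2) c) (hn : 1 ≤ n) (hψ : ∀ k, 1 ≤ k → ψ k ≠ 0) {φ : ℝ → ℝ}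
    (hφ : SInf φ) (h0 : fourierA φ 0 = 0) (x : ℝ) :
    tentSum φ (β * π / 2) n c x ≤
      classSup ψ β (ZygmundSum (fun k => (k : ℝ) / ψ k) n) := by
  have hd := h.isPsiDeriv_psiIntegral hψ hφ h0
  have hc := h.continuous_psiIntegral hφ
  have hp := periodic_psiIntegral ψ φ (β * π / 2) n c
  have hx := h.sub_zygmundSum_eq hn hψ hc hp hd
  set S := (1 / π) * ∑' i, c i * ∫ u in (-π)..π, |tentKernel n (i + 1) (β * π / 2) u|
  have hbdd : BddAbove (Set.range fun x => |tentSum φ (β * π / 2) n c x|) := by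
    refine ⟨S, ?_⟩
    rintro _ ⟨y, rfl⟩
    exact h.abs_tentSum_le hφ y
  have hsup : BddAbove {e | ∃ f, ClassC ψ β f ∧
      e = ⨆ x : ℝ, |f x - ZygmundSum (fun k => (k : ℝ) / ψ k) n f x|} := by
    refine ⟨S, ?_⟩
    rintro _ ⟨f, hf, rfl⟩
    exact h.classSup_le hn hψ hf
  refine le_trans ?_ (le_csSup hsup ⟨_, ⟨hc, hp, φ, hd⟩, rfl⟩)
  simp_rw [hx]
  exact (le_abs_self _).trans (le_ciSup hbdd x)

/-- The deviation of the Zygmund sums is governed by the main part of the kernel. -/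
lemma abs_classSup_sub_le {ψ : ℝ → ℝ} (hψ : MClass ψ) {n : ℕ} (hn : 1 ≤ n) {m : ℝ} (hm1 : 1 ≤ m)
    (hmn : m ≤ n) {K : ℝ}
    (hs : Summable fun i : ℕ => ((i : ℝ) + 1) * secondDiff (fun j : ℕ => ψ ((n : ℝ) + j)) i *
      (1 + Real.log (2 + ((i : ℝ) + 1) / m) + m / ((i : ℝ) + 1)))
    (hK : ∑' i : ℕ, ((i : ℝ) + 1) * secondDiff (fun j : ℕ => ψ ((n : ℝ) + j)) i *
      (1 + Real.log (2 + ((i : ℝ) + 1) / m) + m / ((i : ℝ) + 1)) ≤ K * ψ n) (β : ℝ) :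
    |classSup (fun k : ℕ => ψ k) β (ZygmundSum (fun k : ℕ => (k : ℝ) / ψ k) n) -
      (1 / π) * (ψ n * ∫ t in (-π)..π, |mainKernel n m (β * π / 2) t|)| ≤
      (1 / π) * (38 * (K * ψ n)) := by
  set γ := β * π / 2 with hγ
  set c : ℕ → ℝ := fun i => ((i : ℝ) + 1) * secondDiff (fun j : ℕ => ψ ((n : ℝ) + j)) i with hcd
  set R : ℕ → ℝ := fun i => 1 + Real.log (2 + ((i : ℝ) + 1) / m) + m / ((i : ℝ) + 1) with hR
  set I := ∫ t in (-π)..π, |mainKernel n m γ t| with hI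
  have hc0 : ∀ i, 0 ≤ c i := fun i => mul_nonneg (by positivity) (hψ.secondDiff_nonneg hn i)
  have hcs : HasSum c (ψ n) := by
    have := hasSum_mul_secondDiff (hψ.antitone_nat hn) (hψ.secondDiff_nonneg hn) (hψ.tendsto_nat n)
    simpa only [Nat.cast_zero, add_zero] using this
  have hRc : HasSum (fun i => c i * R i) (∑' i, c i * R i) := Summable.hasSum hs
  have hT : ∀ i, ∫ u in (-π)..π, |tentKernel n (i + 1) γ u| ≤ I + 38 * R i := fun i => by
    have := integral_abs_tentKernel_le hn (Nat.le_add_left 1 i) hm1 hmn γ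
    push_cast at this
    exact this
  have hT0 : ∀ i, 0 ≤ ∫ u in (-π)..π, |tentKernel n (i + 1) γ u| := fun i =>
    intervalIntegral.integral_nonneg (by linarith [Real.pi_pos]) fun _ _ => abs_nonneg _
  have hup : HasSum (fun i => c i * (I + 38 * R i)) (ψ n * I + 38 * ∑' i, c i * R i) := by
    refine ((hcs.mul_right I).add (hRc.mul_left 38)).congr_fun fun i => ?_
    ring
  have hlo : HasSum (fun i => c i * ((1 / π) * (I - 38 * R i)))
      ((1 / π) * (ψ n * I - 38 * ∑' i, c i * R i)) := by
    refine (((hcs.mul_right I).sub (hRc.mul_left 38)).mul_left (1 / π)).congr_fun fun i => ?_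
    ring
  have hsum : Summable fun i => c i * ∫ u in (-π)..π, |tentKernel n (i + 1) γ u| :=
    Summable.of_nonneg_of_le (fun i => mul_nonneg (hc0 i) (hT0 i))
      (fun i => mul_le_mul_of_nonneg_left (hT i) (hc0 i)) hup.summable
  have h : TentExpansion (fun k : ℕ => ψ k) n γ c := hψ.tentExpansion hn hsum
  have hψ0 : ∀ k : ℕ, 1 ≤ k → ψ k ≠ 0 := fun k hk => (hψ.1 k (by exact_mod_cast hk)).ne'
  have hle : ∑' i, c i * ∫ u in (-π)..π, |tentKernel n (i + 1) γ u| ≤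
      ψ n * I + 38 * ∑' i, c i * R i :=
    hasSum_le (fun i => mul_le_mul_of_nonneg_left (hT i) (hc0 i)) hsum.hasSum hup
  have hpi : 0 < 1 / π := by positivity
  have hU : classSup (fun k : ℕ => ψ k) β (ZygmundSum (fun k : ℕ => (k : ℝ) / ψ k) n) ≤
      (1 / π) * (ψ n * I + 38 * (K * ψ n)) := by
    have h1 : (1 / π) * ∑' i, c i * ∫ u in (-π)..π, |tentKernel n (i + 1) γ u| ≤
        (1 / π) * (ψ n * I + 38 * (K * ψ n)) :=
      mul_le_mul_of_nonneg_left (by linarith) hpi.le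
    refine Real.sSup_le ?_ (le_trans (mul_nonneg hpi.le (tsum_nonneg fun i =>
      mul_nonneg (hc0 i) (hT0 i))) h1)
    rintro _ ⟨f, hf, rfl⟩
    exact (h.classSup_le hn hψ0 hf).trans h1
  have hL : (1 / π) * (ψ n * I - 38 * (K * ψ n)) ≤
      classSup (fun k : ℕ => ψ k) β (ZygmundSum (fun k : ℕ => (k : ℝ) / ψ k) n) := by
    obtain ⟨φ, hφm, hφp, hφ1, hφ0, hφM⟩ := exists_extremal n hm1 γ
    have hφ : SInf φ := ⟨hφm, hφp, Eventually.of_forall hφ1⟩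
    have h0 : fourierA φ 0 = 0 := by
      simp [fourierA, hφ0]
    refine le_trans ?_ (h.le_classSup hn hψ0 hφ h0 0)
    calc _ ≤ (1 / π) * (ψ n * I - 38 * ∑' i, c i * R i) :=
          mul_le_mul_of_nonneg_left (by linarith) hpi.le
      _ ≤ _ := by
          have hts : Summable fun i => c i * tentMean φ γ n (i + 1) 0 :=
            Summable.of_norm_bounded (hsum.mul_left (1 / π)) fun i => h.abs_term_le hφ i 0
          refine hasSum_le (fun i => mul_le_mul_of_nonneg_left ?_ (hc0 i)) hlo hts.hasSum
          have := le_tentMean_zero hn (Nat.le_add_left 1 i) hm1 hmn hφ hφM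
          push_cast at this
          exact this
  rw [abs_le]
  constructor <;> linarith

/-- for `ψ ∈ F` and `φ(k) = k/ψ(k)` there is `C = C(ψ) > 0` with
`|E(C^ψ_{β,∞}; Z^φ_n) - (4/π²) ψ(n) A_n^ψ| ≤ C ψ(n)` for all `n` and `β`, where `A_n^ψ` is
`ln n` if `T(n) ≤ 1`, `ln(n/T(n))` if `1 ≤ T(n) ≤ n`, `ln(T(n)/n)` if `T(n) ≥ n`. -/
theorem statement3 (ψ : ℝ → ℝ) (hψ : FClass ψ) :
    ∃ C > (0 : ℝ), ∀ (β : ℝ) (n : ℕ), 1 ≤ n →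
      |classSup (fun k : ℕ => ψ k) β (ZygmundSum (fun k : ℕ => (k : ℝ) / ψ k) n) -
        4 / π ^ 2 * ψ n *
          (if eta ψ n - n ≤ 1 then Real.log n
           else if eta ψ n - n ≤ n then Real.log (n / (eta ψ n - n))
           else Real.log ((eta ψ n - n) / n))| ≤ C * ψ n := by
  obtain ⟨B, C₁, D, hB, hscale⟩ := hψ.exists_scale
  set K : ℝ := 1 + Real.log 6 + 4 * 8 * Real.log B + C₁ with hK
  refine ⟨38 * |K| + 2 + |D|, by positivity, fun β n hn => ?_⟩
  obtain ⟨m, hm1, hmn, hlog, hd, J, hJ, haJ⟩ := hscale n hn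
  change |_ - 4 / π ^ 2 * ψ n * logScale ψ n| ≤ _
  have hM := hψ.1
  have hψn : 0 < ψ n := hM.1 n (by exact_mod_cast hn)
  obtain ⟨hs, hle⟩ := summable_log_moment (m := m) (B := B) (C₀ := 8) (C₁ := C₁)
    (hM.antitone_nat hn) (hM.secondDiff_nonneg hn) (hM.tendsto_nat n) (by linarith) hB J hJ
    (fun i => by simpa using haJ i) (by simpa using hd)
  simp only [Nat.cast_zero, add_zero] at hle
  have h1 := abs_classSup_sub_le hM hn hm1 hmn hs hle β
  have h2 := abs_integral_abs_mainKernel_sub_le hn hm1 hmn (β * π / 2)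
  set E := classSup (fun k : ℕ => ψ k) β (ZygmundSum (fun k : ℕ => (k : ℝ) / ψ k) n)
  set I := ∫ t in (-π)..π, |mainKernel n m (β * π / 2) t|
  set L := Real.log (n / m)
  have hπ := Real.pi_gt_three
  have hπ1 : 1 / π ≤ 1 := by rw [div_le_one (by linarith)]; linarith
  have hπ2 : 4 / π ^ 2 ≤ 1 := by rw [div_le_one (by positivity)]; nlinarith
  have hπ0 : 0 < 1 / π := by positivity
  have e : E - 4 / π ^ 2 * ψ n * logScale ψ n = (E - 1 / π * (ψ n * I)) +
      ψ n * (1 / π) * (I - 4 / π * L) + -(4 / π ^ 2 * ψ n * (logScale ψ n - L)) := by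
    field_simp
    ring
  have b1 : 1 / π * (38 * (K * ψ n)) ≤ 38 * |K| * ψ n := by
    calc _ ≤ 1 / π * (38 * (|K| * ψ n)) := by
          gcongr
          exact le_abs_self K
      _ ≤ 1 * (38 * (|K| * ψ n)) := by gcongr
      _ = _ := by ring
  have b2 : |ψ n * (1 / π) * (I - 4 / π * L)| ≤ 2 * ψ n := by
    rw [abs_mul, abs_of_pos (by positivity : 0 < ψ n * (1 / π))]
    calc _ ≤ ψ n * (1 / π) * (2 * π) := by gcongr
      _ = _ := by field_simp
  have b3 : |-(4 / π ^ 2 * ψ n * (logScale ψ n - L))| ≤ |D| * ψ n := by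
    rw [abs_neg, abs_mul, abs_of_pos (by positivity : 0 < 4 / π ^ 2 * ψ n)]
    calc _ ≤ 1 * ψ n * |D| := mul_le_mul (by gcongr) (hlog.trans (le_abs_self D)) (abs_nonneg _)
          (by positivity)
      _ = _ := by ring
  rw [e]
  refine (abs_add_three _ _ _).trans ?_
  linarith
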